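/- Let T be a rooted ternary tree with n leaves labeled 1,…,n in left-to-right order, each internal node v carrying strengths 0 < s_{L,v} < s_{C,v} < s_{R,v} with s_{L,v}/s_{C,v} < 1/2 and s_{C,v}/s_{R,v} < 1/2. Then there is a constant C, depending only on the ratios of the strengths at the internal nodes of T and not on n, such that the chain M_tree on S_n has mixing time t(M_tree) ≤ C·n^{10}·log n. -/

import Mathlib

open Finset

/-- Total-variation mixing time: the least `T` such that for every starting state `x`
and every `t ≥ T`, the TV distance between `P^t(x, ·)` and `π` is at most `1/4`. -/
noncomputable def mixingTime {Ω : Type*} [Fintype Ω] [DecidableEq Ω]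
    (P : Matrix Ω Ω ℝ) (π : Ω → ℝ) : ℕ :=
  sInf {T : ℕ | ∀ x : Ω, ∀ t : ℕ, T ≤ t →
    (1 / 2) * ∑ y : Ω, |(P ^ t) x y - π y| ≤ 1 / 4}



/-- A rooted ternary tree; each internal node carries strengths
`sL, sC, sR` for its left, center and right child slots. -/
inductive STree : Type
  | leaf : STree
  | node (sL sC sR : ℝ) (l c r : STree) : STree

namespace STree

/-- Number of leaves of a ternary tree. -/
def numLeaves : STree → ℕ
  | .leaf => 1
  | .node _ _ _ l c r => l.numLeaves + c.numLeaves + r.numLeaves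

/-- `pSwap T i j` is the probability `p_{i,j}` (for leaves `i < j`, 0-indexed
left-to-right) of putting `i` ahead of `j`:  `s_{X,v}/(s_{X,v}+s_{Y,v})` where `v` is
the lowest common ancestor, `X` the child slot of `v` containing `j`, `Y` that
containing `i`. -/
noncomputable def pSwap : STree → ℕ → ℕ → ℝ
  | .leaf, _, _ => 0
  | .node sL sC sR l c r, i, j =>
    if j < l.numLeaves then pSwap l i j
    else if i < l.numLeaves then
      if j < l.numLeaves + c.numLeaves then sC / (sC + sL) else sR / (sR + sL)
    else if j < l.numLeaves + c.numLeaves then pSwap c (i - l.numLeaves) (j - l.numLeaves)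
    else if i < l.numLeaves + c.numLeaves then sR / (sR + sC)
    else pSwap r (i - l.numLeaves - c.numLeaves) (j - l.numLeaves - c.numLeaves)

/-- Every internal node has strengths `0 < s_L < s_C < s_R` with
`s_L/s_C < 1/2` and `s_C/s_R < 1/2`. -/
def Valid : STree → Prop
  | .leaf => True
  | .node sL sC sR l c r =>
      0 < sL ∧ sL < sC ∧ sC < sR ∧ sL / sC < 1 / 2 ∧ sC / sR < 1 / 2 ∧
        l.Valid ∧ c.Valid ∧ r.Valid

/-- All strength ratios at internal nodes are bounded by `qb`. -/
def RatioBound (qb : ℝ) : STree → Prop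
  | .leaf => True
  | .node sL sC sR l c r =>
      sL / sC ≤ qb ∧ sC / sR ≤ qb ∧
        l.RatioBound qb ∧ c.RatioBound qb ∧ r.RatioBound qb

/-- `lcaRange T i j` is the (inclusive) interval of 0-indexed leaf positions of the
subtree rooted at the lowest common ancestor of leaves `i ≤ j`. -/
def lcaRange : STree → ℕ → ℕ → ℕ × ℕ
  | .leaf, _, _ => (0, 0)
  | .node _ _ _ l c r, i, j =>
    if j < l.numLeaves then lcaRange l i j
    else if l.numLeaves ≤ i ∧ j < l.numLeaves + c.numLeaves then
      ((lcaRange c (i - l.numLeaves) (j - l.numLeaves)).1 + l.numLeaves,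
       (lcaRange c (i - l.numLeaves) (j - l.numLeaves)).2 + l.numLeaves)
    else if l.numLeaves + c.numLeaves ≤ i then
      ((lcaRange r (i - l.numLeaves - c.numLeaves) (j - l.numLeaves - c.numLeaves)).1
          + l.numLeaves + c.numLeaves,
       (lcaRange r (i - l.numLeaves - c.numLeaves) (j - l.numLeaves - c.numLeaves)).2
          + l.numLeaves + c.numLeaves)
    else (0, l.numLeaves + c.numLeaves + r.numLeaves - 1)

end STree

/-- Transition matrix of the league hierarchy chain `L₃` on `S_n`,
`n` the number of leaves of `T` (leaves labeled `0,…,n-1` left to right). -/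
noncomputable def leagueP (T : STree) :
    Matrix (Equiv.Perm (Fin T.numLeaves)) (Equiv.Perm (Fin T.numLeaves)) ℝ :=
  fun σ τ => (1 / ((T.numLeaves : ℝ) - 1)) *
    ∑ i : Fin T.numLeaves, ∑ j : Fin T.numLeaves,
      if (j : ℕ) = (i : ℕ) + 1 then
        (T.pSwap (min (σ i : ℕ) (σ j : ℕ)) (max (σ i : ℕ) (σ j : ℕ))) *
          (if τ = (if (σ i : ℕ) ≤ (σ j : ℕ) then σ else σ * Equiv.swap i j) then 1 else 0)
        + (1 - T.pSwap (min (σ i : ℕ) (σ j : ℕ)) (max (σ i : ℕ) (σ j : ℕ))) *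
          (if τ = (if (σ i : ℕ) ≤ (σ j : ℕ) then σ * Equiv.swap i j else σ) then 1 else 0)
      else 0

/-- Transition matrix of the chain `M_tree` on `S_n`. -/
noncomputable def treeP (T : STree) :
    Matrix (Equiv.Perm (Fin T.numLeaves)) (Equiv.Perm (Fin T.numLeaves)) ℝ :=
  fun σ τ => (1 / ((T.numLeaves).choose 2 : ℝ)) *
    ∑ i : Fin T.numLeaves, ∑ j : Fin T.numLeaves,
      if i < j then
        if ∀ l, i < l → l < j →
            ¬((T.lcaRange (min (σ i : ℕ) (σ j : ℕ)) (max (σ i : ℕ) (σ j : ℕ))).1 ≤ (σ l : ℕ) ∧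
              (σ l : ℕ) ≤ (T.lcaRange (min (σ i : ℕ) (σ j : ℕ)) (max (σ i : ℕ) (σ j : ℕ))).2) then
          (T.pSwap (min (σ i : ℕ) (σ j : ℕ)) (max (σ i : ℕ) (σ j : ℕ))) *
            (if τ = (if (σ i : ℕ) ≤ (σ j : ℕ) then σ else σ * Equiv.swap i j) then 1 else 0)
          + (1 - T.pSwap (min (σ i : ℕ) (σ j : ℕ)) (max (σ i : ℕ) (σ j : ℕ))) *
            (if τ = (if (σ i : ℕ) ≤ (σ j : ℕ) then σ * Equiv.swap i j else σ) then 1 else 0)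
        else (if τ = σ then 1 else 0)
      else 0

/-- Unnormalized stationary weight common to `L₃` and `M_tree`:
`∏_{u<v, v before u in σ} (1-p_{u,v})/p_{u,v}`. -/
noncomputable def treeW (T : STree) (σ : Equiv.Perm (Fin T.numLeaves)) : ℝ :=
  ∏ u : Fin T.numLeaves, ∏ v : Fin T.numLeaves,
    if u < v ∧ σ.symm v < σ.symm u then
      (1 - T.pSwap (u : ℕ) (v : ℕ)) / T.pSwap (u : ℕ) (v : ℕ)
    else 1

/-- Common stationary distribution of `L₃` and `M_tree`. -/
noncomputable def treePi (T : STree) (σ : Equiv.Perm (Fin T.numLeaves)) : ℝ :=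
  treeW T σ / ∑ τ : Equiv.Perm (Fin T.numLeaves), treeW T τ

namespace TreeMixing

/-- A reversible weighted system: `W` is an unnormalized stationary weight and `G` a generator.
The constants record a Poincaré inequality (`K`), an upper bound for the Dirichlet form (`d`), and
a factorization of `W` into at most `m` powers `r ^ I`, with `I ≤ M`, such that `a ^ I` has
a geometric drift at rate `c`. -/
structure IsSystem (K a c d : ℝ) (m M : ℕ) {Ω : Type*} [Fintype Ω] (W : Ω → ℝ)
    (G : (Ω → ℝ) → Ω → ℝ) : Prop where
  weight_pos : ∀ x, 0 < W x
  gen_const : ∀ b x, G (fun _ => b) x = 0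
  symm : ∀ F H : Ω → ℝ, ∑ x, W x * F x * G H x = ∑ x, W x * H x * G F x
  poincare : ∀ F : Ω → ℝ, (∑ x, W x) * (∑ x, W x * F x ^ 2) - (∑ x, W x * F x) ^ 2 ≤
    K * (∑ x, W x) * ∑ x, W x * F x * (-G F x)
  dirichlet_le : ∀ F : Ω → ℝ, ∑ x, W x * F x * (-G F x) ≤ d * ∑ x, W x * F x ^ 2
  drift : ∃ l : List (ℝ × (Ω → ℕ)), l.length ≤ m ∧
    (∀ x, W x = (l.map fun o => o.1 ^ o.2 x).prod) ∧
    ∀ o ∈ l, 0 < o.1 ∧ o.1 ≤ 1 ∧ (∀ x, o.2 x ≤ M) ∧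
      ∀ x, G (fun y => a ^ o.2 y) x ≤ -c * (a ^ o.2 x - 1) + o.1

section Product

variable {Ω₁ Ω₂ : Type*}

/-- The generator of two independent systems. -/
def prodGen (G₁ : (Ω₁ → ℝ) → Ω₁ → ℝ) (G₂ : (Ω₂ → ℝ) → Ω₂ → ℝ) (F : Ω₁ × Ω₂ → ℝ)
    (x : Ω₁ × Ω₂) : ℝ :=
  G₁ (fun a => F (a, x.2)) x.1 + G₂ (fun b => F (x.1, b)) x.2

variable [Fintype Ω₁] [Fintype Ω₂]

theorem sum_mul_sum_sq_sub {Ω : Type*} [Fintype Ω] (W F : Ω → ℝ) :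
    (∑ x, W x) * (∑ x, W x * F x ^ 2) - (∑ x, W x * F x) ^ 2 =
      1 / 2 * ∑ x, ∑ y, W x * W y * (F x - F y) ^ 2 := by
  have h : ∀ x y, W x * W y * (F x - F y) ^ 2 =
      (W x * F x ^ 2) * W y + W x * (W y * F y ^ 2) - 2 * ((W x * F x) * (W y * F y)) := by
    intro x y; ring
  simp only [h, Finset.sum_sub_distrib, Finset.sum_add_distrib, ← Finset.mul_sum,
    ← Finset.sum_mul]
  ring

theorem poincare_prod {W₁ : Ω₁ → ℝ} {W₂ : Ω₂ → ℝ} (h₁ : ∀ x, 0 < W₁ x) (h₂ : ∀ x, 0 < W₂ x)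
    (F : Ω₁ × Ω₂ → ℝ) :
    (∑ x, W₁ x * ∑ y, W₂ y) * (∑ x, W₁ x * ∑ y, W₂ y * F (x, y) ^ 2)
        - (∑ x, W₁ x * ∑ y, W₂ y * F (x, y)) ^ 2 ≤
      (∑ y, W₂ y) * ∑ y, W₂ y * ((∑ x, W₁ x) * (∑ x, W₁ x * F (x, y) ^ 2)
        - (∑ x, W₁ x * F (x, y)) ^ 2) +
      (∑ x, W₁ x) * ∑ x, W₁ x * ((∑ y, W₂ y) * (∑ y, W₂ y * F (x, y) ^ 2)
        - (∑ y, W₂ y * F (x, y)) ^ 2) := by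
  set Z₁ := ∑ x, W₁ x
  set Z₂ := ∑ y, W₂ y
  set g : Ω₂ → ℝ := fun y => ∑ x, W₁ x * F (x, y) with hg
  have e1 : ∑ x, W₁ x * ∑ y, W₂ y * F (x, y) = ∑ y, W₂ y * g y := by
    simp only [hg, Finset.mul_sum]
    rw [Finset.sum_comm]
    exact Finset.sum_congr rfl fun _ _ => Finset.sum_congr rfl fun _ _ => by ring
  have e2 : ∑ x, W₁ x * ∑ y, W₂ y * F (x, y) ^ 2 = ∑ y, W₂ y * ∑ x, W₁ x * F (x, y) ^ 2 := by
    simp only [Finset.mul_sum]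
    rw [Finset.sum_comm]
    exact Finset.sum_congr rfl fun _ _ => Finset.sum_congr rfl fun _ _ => by ring
  have key : Z₂ * (∑ y, W₂ y * g y ^ 2) - (∑ y, W₂ y * g y) ^ 2 ≤
      Z₁ * ∑ x, W₁ x * (Z₂ * (∑ y, W₂ y * F (x, y) ^ 2) - (∑ y, W₂ y * F (x, y)) ^ 2) := by
    have hx : ∀ x, Z₂ * (∑ y, W₂ y * F (x, y) ^ 2) - (∑ y, W₂ y * F (x, y)) ^ 2 =
        1 / 2 * ∑ y, ∑ z, W₂ y * W₂ z * (F (x, y) - F (x, z)) ^ 2 := fun x =>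
      sum_mul_sum_sq_sub W₂ (fun y => F (x, y))
    simp only [hx]
    rw [sum_mul_sum_sq_sub]
    have : Z₁ * ∑ x, W₁ x * (1 / 2 * ∑ y, ∑ z, W₂ y * W₂ z * (F (x, y) - F (x, z)) ^ 2) =
        1 / 2 * ∑ y, ∑ z, W₂ y * W₂ z * (Z₁ * ∑ x, W₁ x * (F (x, y) - F (x, z)) ^ 2) := by
      simp only [Finset.mul_sum]
      rw [Finset.sum_comm]
      refine Finset.sum_congr rfl fun y _ => ?_
      rw [Finset.sum_comm]
      refine Finset.sum_congr rfl fun z _ => Finset.sum_congr rfl fun x _ => by ring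
    rw [this]
    refine mul_le_mul_of_nonneg_left ?_ (by norm_num)
    refine Finset.sum_le_sum fun y _ => Finset.sum_le_sum fun z _ => ?_
    refine mul_le_mul_of_nonneg_left ?_ (mul_pos (h₂ y) (h₂ z)).le
    have hgd : g y - g z = ∑ x, W₁ x * (F (x, y) - F (x, z)) := by
      simp only [hg, mul_sub, Finset.sum_sub_distrib]
    rw [hgd]
    have := sum_mul_sum_sq_sub W₁ (fun x => F (x, y) - F (x, z))
    have h0 : 0 ≤ 1 / 2 * ∑ x, ∑ x', W₁ x * W₁ x' *
        ((F (x, y) - F (x, z)) - (F (x', y) - F (x', z))) ^ 2 := by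
      refine mul_nonneg (by norm_num) (Finset.sum_nonneg fun x _ => Finset.sum_nonneg fun x' _ => ?_)
      exact mul_nonneg (mul_pos (h₁ x) (h₁ x')).le (sq_nonneg _)
    linarith
  have e3 : Z₂ * ∑ y, W₂ y * (Z₁ * (∑ x, W₁ x * F (x, y) ^ 2) - g y ^ 2) =
      Z₂ * Z₁ * (∑ y, W₂ y * ∑ x, W₁ x * F (x, y) ^ 2) - Z₂ * ∑ y, W₂ y * g y ^ 2 := by
    rw [mul_assoc, ← mul_sub, Finset.mul_sum (f := fun y => W₂ y * ∑ x, W₁ x * F (x, y) ^ 2),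
      ← Finset.sum_sub_distrib]
    congr 1
    exact Finset.sum_congr rfl fun y _ => by ring
  have e4 : ∑ x, W₁ x * Z₂ = Z₁ * Z₂ := (Finset.sum_mul _ _ _).symm
  rw [e4, e1, e2]
  have e5 : ∀ y, ∑ x, W₁ x * F (x, y) = g y := fun _ => rfl
  simp only [e5]
  rw [e3]
  nlinarith [key]

variable {K a c d₁ d₂ : ℝ} {m₁ m₂ M : ℕ}

theorem sum_prod_gen_left (W₁ : Ω₁ → ℝ) (W₂ : Ω₂ → ℝ) (A : Ω₁ × Ω₂ → ℝ) :
    ∑ x : Ω₁ × Ω₂, W₁ x.1 * W₂ x.2 * A x = ∑ y, W₂ y * ∑ x, W₁ x * A (x, y) := by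
  rw [Fintype.sum_prod_type_right]
  refine Finset.sum_congr rfl fun y _ => ?_
  rw [Finset.mul_sum]
  exact Finset.sum_congr rfl fun x _ => by ring

theorem sum_prod_gen_right (W₁ : Ω₁ → ℝ) (W₂ : Ω₂ → ℝ) (A : Ω₁ × Ω₂ → ℝ) :
    ∑ x : Ω₁ × Ω₂, W₁ x.1 * W₂ x.2 * A x = ∑ x, W₁ x * ∑ y, W₂ y * A (x, y) := by
  rw [Fintype.sum_prod_type]
  refine Finset.sum_congr rfl fun y _ => ?_
  rw [Finset.mul_sum]
  exact Finset.sum_congr rfl fun x _ => by ring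

theorem sum_prodGen (W₁ : Ω₁ → ℝ) (W₂ : Ω₂ → ℝ) (G₁ : (Ω₁ → ℝ) → Ω₁ → ℝ)
    (G₂ : (Ω₂ → ℝ) → Ω₂ → ℝ) (F H : Ω₁ × Ω₂ → ℝ) :
    ∑ x : Ω₁ × Ω₂, W₁ x.1 * W₂ x.2 * F x * prodGen G₁ G₂ H x =
      (∑ y, W₂ y * ∑ x, W₁ x * F (x, y) * G₁ (fun a => H (a, y)) x) +
      ∑ x, W₁ x * ∑ y, W₂ y * F (x, y) * G₂ (fun b => H (x, b)) y := by
  simp only [prodGen, mul_add, Finset.sum_add_distrib]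
  congr 1
  · simpa only [mul_assoc] using
      sum_prod_gen_left W₁ W₂ (fun x => F x * G₁ (fun a => H (a, x.2)) x.1)
  · simpa only [mul_assoc] using
      sum_prod_gen_right W₁ W₂ (fun x => F x * G₂ (fun b => H (x.1, b)) x.2)

theorem IsSystem.prod {W₁ : Ω₁ → ℝ} {W₂ : Ω₂ → ℝ} {G₁ : (Ω₁ → ℝ) → Ω₁ → ℝ}
    {G₂ : (Ω₂ → ℝ) → Ω₂ → ℝ} (h₁ : IsSystem K a c d₁ m₁ M W₁ G₁)
    (h₂ : IsSystem K a c d₂ m₂ M W₂ G₂) :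
    IsSystem K a c (d₁ + d₂) (m₁ + m₂) M (fun x : Ω₁ × Ω₂ => W₁ x.1 * W₂ x.2)
      (prodGen G₁ G₂) where
  weight_pos x := mul_pos (h₁.weight_pos _) (h₂.weight_pos _)
  gen_const b x := by simp [prodGen, h₁.gen_const, h₂.gen_const]
  symm F H := by
    rw [sum_prodGen, sum_prodGen]
    congr 1
    · exact Finset.sum_congr rfl fun y _ => by
        rw [h₁.symm (fun a => F (a, y)) (fun a => H (a, y))]
    · exact Finset.sum_congr rfl fun x _ => by
        rw [h₂.symm (fun b => F (x, b)) (fun b => H (x, b))]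
  poincare F := by
    have hZ : ∑ x : Ω₁ × Ω₂, W₁ x.1 * W₂ x.2 = (∑ x, W₁ x) * ∑ y, W₂ y := by
      rw [Fintype.sum_prod_type, Finset.sum_mul]
      exact Finset.sum_congr rfl fun x _ => by rw [Finset.mul_sum]
    have hmain := poincare_prod h₁.weight_pos h₂.weight_pos F
    rw [← Finset.sum_mul] at hmain
    simp only [mul_neg, Finset.sum_neg_distrib]
    rw [sum_prodGen, hZ, sum_prod_gen_right W₁ W₂ (fun x => F x ^ 2),
      sum_prod_gen_right W₁ W₂ F]
    refine hmain.trans ?_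
    have hZ₁ : 0 ≤ ∑ x, W₁ x := Finset.sum_nonneg fun x _ => (h₁.weight_pos x).le
    have hZ₂ : 0 ≤ ∑ x, W₂ x := Finset.sum_nonneg fun x _ => (h₂.weight_pos x).le
    have A : ∑ y, W₂ y * ((∑ x, W₁ x) * (∑ x, W₁ x * F (x, y) ^ 2)
        - (∑ x, W₁ x * F (x, y)) ^ 2) ≤
        K * (∑ x, W₁ x) * -(∑ y, W₂ y * ∑ x, W₁ x * F (x, y) * G₁ (fun a => F (a, y)) x) := by
      rw [← Finset.sum_neg_distrib, Finset.mul_sum]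
      refine Finset.sum_le_sum fun y _ => ?_
      have := mul_le_mul_of_nonneg_left (h₁.poincare (fun x => F (x, y))) (h₂.weight_pos y).le
      simp only [mul_neg, Finset.sum_neg_distrib] at this
      linarith
    have B : ∑ x, W₁ x * ((∑ y, W₂ y) * (∑ y, W₂ y * F (x, y) ^ 2)
        - (∑ y, W₂ y * F (x, y)) ^ 2) ≤
        K * (∑ x, W₂ x) * -(∑ x, W₁ x * ∑ y, W₂ y * F (x, y) * G₂ (fun b => F (x, b)) y) := by
      rw [← Finset.sum_neg_distrib, Finset.mul_sum]
      refine Finset.sum_le_sum fun x _ => ?_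
      have := mul_le_mul_of_nonneg_left (h₂.poincare (fun y => F (x, y))) (h₁.weight_pos x).le
      simp only [mul_neg, Finset.sum_neg_distrib] at this
      linarith
    have A' := mul_le_mul_of_nonneg_left A hZ₂
    have B' := mul_le_mul_of_nonneg_left B hZ₁
    linarith
  dirichlet_le F := by
    simp only [mul_neg, Finset.sum_neg_distrib]
    rw [sum_prodGen, add_mul]
    nth_rewrite 1 [sum_prod_gen_left W₁ W₂ (fun x => F x ^ 2)]
    rw [sum_prod_gen_right W₁ W₂ (fun x => F x ^ 2), neg_add]
    rw [← Finset.sum_neg_distrib, ← Finset.sum_neg_distrib, Finset.mul_sum, Finset.mul_sum]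
    refine add_le_add (Finset.sum_le_sum fun y _ => ?_) (Finset.sum_le_sum fun x _ => ?_)
    · have := mul_le_mul_of_nonneg_left (h₁.dirichlet_le (fun x => F (x, y))) (h₂.weight_pos y).le
      simp only [mul_neg, Finset.sum_neg_distrib] at this
      linarith
    · have := mul_le_mul_of_nonneg_left (h₂.dirichlet_le (fun y => F (x, y))) (h₁.weight_pos x).le
      simp only [mul_neg, Finset.sum_neg_distrib] at this
      linarith
  drift := by
    obtain ⟨l₁, hl₁, hW₁, hd₁⟩ := h₁.drift
    obtain ⟨l₂, hl₂, hW₂, hd₂⟩ := h₂.drift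
    refine ⟨l₁.map (fun o => (o.1, fun x => o.2 x.1)) ++ l₂.map (fun o => (o.1, fun x => o.2 x.2)),
      by simpa using add_le_add hl₁ hl₂, fun x => ?_, fun o ho => ?_⟩
    · simp [hW₁, hW₂, Function.comp_def]
    · rcases List.mem_append.1 ho with h | h
      · obtain ⟨o', ho', rfl⟩ := List.mem_map.1 h
        obtain ⟨p1, p2, p3, p4⟩ := hd₁ o' ho'
        refine ⟨p1, p2, fun x => p3 _, fun x => ?_⟩
        simpa [prodGen, h₂.gen_const] using p4 x.1
      · obtain ⟨o', ho', rfl⟩ := List.mem_map.1 h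
        obtain ⟨p1, p2, p3, p4⟩ := hd₂ o' ho'
        refine ⟨p1, p2, fun x => p3 _, fun x => ?_⟩
        simpa [prodGen, h₁.gen_const] using p4 x.2

/-- Transport of a system along an equivalence. -/
theorem IsSystem.congr {d : ℝ} {m : ℕ} {W₁ : Ω₁ → ℝ} {G₁ : (Ω₁ → ℝ) → Ω₁ → ℝ}
    (h : IsSystem K a c d m M W₁ G₁) (e : Ω₁ ≃ Ω₂) {W₂ : Ω₂ → ℝ} {G₂ : (Ω₂ → ℝ) → Ω₂ → ℝ}
    (hW : ∀ x, W₂ (e x) = W₁ x) (hG : ∀ F x, G₂ F (e x) = G₁ (F ∘ e) x) :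
    IsSystem K a c d m M W₂ G₂ where
  weight_pos x := by
    obtain ⟨x, rfl⟩ := e.surjective x
    exact hW x ▸ h.weight_pos x
  gen_const b x := by
    obtain ⟨x, rfl⟩ := e.surjective x
    exact (hG _ x).trans (h.gen_const b x)
  symm F H := by
    simp only [← e.sum_comp, hW, hG]
    exact h.symm (F ∘ e) (H ∘ e)
  poincare F := by
    simp only [← e.sum_comp, hW, hG]
    exact h.poincare (F ∘ e)
  dirichlet_le F := by
    simp only [← e.sum_comp, hW, hG]
    exact h.dirichlet_le (F ∘ e)
  drift := by
    obtain ⟨l, hl, hW', hd⟩ := h.drift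
    refine ⟨l.map (fun o => (o.1, fun x => o.2 (e.symm x))), by simpa using hl, fun x => ?_,
      fun o ho => ?_⟩
    · obtain ⟨x, rfl⟩ := e.surjective x
      simp [hW, hW', Function.comp_def]
    · obtain ⟨o', ho', rfl⟩ := List.mem_map.1 ho
      obtain ⟨p1, p2, p3, p4⟩ := hd o' ho'
      refine ⟨p1, p2, fun x => p3 _, fun x => ?_⟩
      obtain ⟨x, rfl⟩ := e.surjective x
      simpa [hG, Function.comp_def] using p4 x

theorem IsSystem.mono {d d' : ℝ} {m m' M' : ℕ} {W₁ : Ω₁ → ℝ} {G₁ : (Ω₁ → ℝ) → Ω₁ → ℝ}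
    (h : IsSystem K a c d m M W₁ G₁) (hd : d ≤ d') (hm : m ≤ m') (hM : M ≤ M') :
    IsSystem K a c d' m' M' W₁ G₁ where
  weight_pos := h.weight_pos
  gen_const := h.gen_const
  symm := h.symm
  poincare := h.poincare
  dirichlet_le F := (h.dirichlet_le F).trans (mul_le_mul_of_nonneg_right hd
    (Finset.sum_nonneg fun x _ => mul_nonneg (h.weight_pos x).le (sq_nonneg _)))
  drift := by
    obtain ⟨l, hl, hW', h'⟩ := h.drift
    refine ⟨l, hl.trans hm, hW', fun o ho => ?_⟩
    obtain ⟨p1, p2, p3, p4⟩ := h' o ho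
    exact ⟨p1, p2, fun x => (p3 x).trans hM, p4⟩

theorem isSystem_of_unique {d : ℝ} {m : ℕ} [Unique Ω₁] (hd : 0 ≤ d) :
    IsSystem K a c d m M (fun _ : Ω₁ => 1) (fun _ _ => 0) where
  weight_pos _ := one_pos
  gen_const _ _ := rfl
  symm _ _ := by simp
  poincare F := by simp
  dirichlet_le F := by simpa using mul_nonneg hd (sq_nonneg _)
  drift := ⟨[], by simp, by simp, by simp⟩

end Product

/-- The generator of a family of independent systems. -/
def piGen {ι : Type*} [Fintype ι] [DecidableEq ι] {Ω : ι → Type*}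
    (G : ∀ s, (Ω s → ℝ) → Ω s → ℝ) (F : (∀ s, Ω s) → ℝ) (ρ : ∀ s, Ω s) : ℝ :=
  ∑ s, G s (fun y => F (Function.update ρ s y)) (ρ s)

theorem IsSystem.pi {K a c : ℝ} {M : ℕ} : ∀ {k : ℕ} {Ω : Fin k → Type} [∀ s, Fintype (Ω s)]
    {d : Fin k → ℝ} {m : Fin k → ℕ} {W : ∀ s, Ω s → ℝ} {G : ∀ s, (Ω s → ℝ) → Ω s → ℝ}
    (_ : ∀ s, IsSystem K a c (d s) (m s) M (W s) (G s)),
    IsSystem K a c (∑ s, d s) (∑ s, m s) M (fun ρ : ∀ s, Ω s => ∏ s, W s (ρ s)) (piGen G)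
  | 0, Ω, _, d, m, W, G, h => by
    have := isSystem_of_unique (Ω₁ := ∀ s : Fin 0, Ω s) (K := K) (a := a) (c := c) (d := 0)
      (m := 0) (M := M) le_rfl
    have hG : piGen G = fun _ _ => 0 := by
      funext F x
      simp [piGen]
    rw [hG]
    simpa using this
  | k + 1, Ω, _, d, m, W, G, h => by
    have h' := IsSystem.prod (h 0) (IsSystem.pi fun s : Fin k => h s.succ)
    rw [Fin.sum_univ_succ, Fin.sum_univ_succ]
    refine h'.congr (Fin.consEquiv Ω) (fun x => ?_) (fun F x => ?_)
    · simp [Fin.prod_univ_succ, Fin.consEquiv]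
    · simp [piGen, prodGen, Fin.sum_univ_succ, Fin.consEquiv, Fin.update_cons_zero, ← Fin.cons_update]

section Moves

variable {Ω κ : Type*} [Fintype Ω] [Fintype κ]

/-- The generator of the chain that applies the move `e k` at rate `q k x`. -/
def moveGen (e : κ → Ω → Ω) (q : κ → Ω → ℝ) (F : Ω → ℝ) (x : Ω) : ℝ :=
  ∑ k, q k x * (F (e k x) - F x)

variable {e : κ → Ω → Ω} {q : κ → Ω → ℝ} {W : Ω → ℝ}

theorem sum_comp_involutive {f : Ω → Ω} (hf : Function.Involutive f) (A : Ω → ℝ) :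
    ∑ x, A (f x) = ∑ x, A x :=
  Equiv.sum_comp hf.toPerm A

theorem moveGen_form (he : ∀ k, Function.Involutive (e k))
    (hrev : ∀ k x, W (e k x) * q k (e k x) = W x * q k x) (F H : Ω → ℝ) :
    ∑ x, W x * F x * moveGen e q H x =
      -(1 / 2 * ∑ k, ∑ x, W x * q k x * ((F (e k x) - F x) * (H (e k x) - H x))) := by
  have h1 : ∑ x, W x * F x * moveGen e q H x =
      ∑ k, ∑ x, W x * q k x * (F x * (H (e k x) - H x)) := by
    rw [Finset.sum_comm]
    refine Finset.sum_congr rfl fun x _ => ?_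
    rw [moveGen, Finset.mul_sum]
    exact Finset.sum_congr rfl fun k _ => by ring
  rw [h1, Finset.mul_sum, ← Finset.sum_neg_distrib]
  refine Finset.sum_congr rfl fun k _ => ?_
  have h2 : ∑ x, W x * q k x * (F x * (H (e k x) - H x)) =
      ∑ x, W x * q k x * (F (e k x) * (H x - H (e k x))) := by
    rw [← sum_comp_involutive (he k)]
    exact Finset.sum_congr rfl fun x _ => by rw [hrev, he k x]
  have h3 : ∑ x, W x * q k x * ((F (e k x) - F x) * (H (e k x) - H x)) =
      -(∑ x, W x * q k x * (F x * (H (e k x) - H x)))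
        - ∑ x, W x * q k x * (F (e k x) * (H x - H (e k x))) := by
    rw [← Finset.sum_neg_distrib, ← Finset.sum_sub_distrib]
    exact Finset.sum_congr rfl fun x _ => by ring
  rw [h3, ← h2]
  ring

theorem moveGen_dirichlet (he : ∀ k, Function.Involutive (e k))
    (hrev : ∀ k x, W (e k x) * q k (e k x) = W x * q k x) (F : Ω → ℝ) :
    ∑ x, W x * F x * (-moveGen e q F x) =
      1 / 2 * ∑ k, ∑ x, W x * q k x * (F (e k x) - F x) ^ 2 := by
  simp only [mul_neg, Finset.sum_neg_distrib]
  rw [moveGen_form he hrev, neg_neg]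
  simp only [sq]

theorem moveGen_dirichlet_le (he : ∀ k, Function.Involutive (e k)) (hW : ∀ x, 0 < W x)
    (hrev : ∀ k x, W (e k x) * q k (e k x) = W x * q k x) (hq : ∀ k x, 0 ≤ q k x)
    (hq1 : ∀ k x, q k x + q k (e k x) = 1) (F : Ω → ℝ) :
    ∑ x, W x * F x * (-moveGen e q F x) ≤ Fintype.card κ * ∑ x, W x * F x ^ 2 := by
  rw [moveGen_dirichlet he hrev, Finset.mul_sum]
  have : ∀ k ∈ (Finset.univ : Finset κ),
      1 / 2 * ∑ x, W x * q k x * (F (e k x) - F x) ^ 2 ≤ ∑ x, W x * F x ^ 2 := by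
    intro k _
    have h1 : ∑ x, W x * q k x * (F (e k x) - F x) ^ 2 ≤
        ∑ x, (W x * F x ^ 2 + W (e k x) * F (e k x) ^ 2) := by
      refine Finset.sum_le_sum fun x _ => ?_
      have hx := hW x
      have hy := hW (e k x)
      have hr := hrev k x
      have h0 := hq k x
      have hs : q k (e k x) = 1 - q k x := by linarith [hq1 k x]
      rw [hs] at hr
      set w := W x
      set v := W (e k x)
      set p := q k x
      have hp : p * (w + v) = v := by linarith
      have hp0 : 0 < w + v := by linarith
      have hpe : p = v / (w + v) := by rw [eq_div_iff hp0.ne', hp]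
      have : w * F x ^ 2 + v * F (e k x) ^ 2 - w * p * (F (e k x) - F x) ^ 2 =
          (w * F x + v * F (e k x)) ^ 2 / (w + v) := by
        rw [hpe]; field_simp; ring
      have h2 : 0 ≤ (w * F x + v * F (e k x)) ^ 2 / (w + v) := by positivity
      linarith
    rw [Finset.sum_add_distrib, sum_comp_involutive (he k) (fun x => W x * F x ^ 2)] at h1
    linarith
  refine (Finset.sum_le_card_nsmul _ _ _ this).trans ?_
  simp

theorem lyapunov_form_le (he : ∀ k, Function.Involutive (e k)) (hW : ∀ x, 0 < W x)
    (hrev : ∀ k x, W (e k x) * q k (e k x) = W x * q k x) (hq : ∀ k x, 0 ≤ q k x)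
    {V : Ω → ℝ} (hV : ∀ x, 0 < V x) (F : Ω → ℝ) :
    ∑ x, W x * F x ^ 2 * (-moveGen e q V x / V x) ≤ ∑ x, W x * F x * (-moveGen e q F x) := by
  have h1 : ∑ x, W x * F x ^ 2 * (-moveGen e q V x / V x) =
      -∑ x, W x * (F x ^ 2 / V x) * moveGen e q V x := by
    rw [← Finset.sum_neg_distrib]
    exact Finset.sum_congr rfl fun x _ => by ring
  rw [h1, moveGen_form he hrev, neg_neg, moveGen_dirichlet he hrev]
  refine mul_le_mul_of_nonneg_left ?_ (by norm_num)
  refine Finset.sum_le_sum fun k _ => Finset.sum_le_sum fun x _ => ?_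
  refine mul_le_mul_of_nonneg_left ?_ (mul_nonneg (hW x).le (hq k x))
  have hx := hV x
  have hy := hV (e k x)
  have : (F (e k x) - F x) ^ 2 - (F (e k x) ^ 2 / V (e k x) - F x ^ 2 / V x) * (V (e k x) - V x)
      = (F (e k x) * V x - F x * V (e k x)) ^ 2 / (V x * V (e k x)) := by
    field_simp; ring
  have h2 : 0 ≤ (F (e k x) * V x - F x * V (e k x)) ^ 2 / (V x * V (e k x)) := by positivity
  linarith

/-- The constant in the local Poincaré inequality for states of height at most `j`. -/
noncomputable def localConst : ℕ → ℝ
  | 0 => 0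
  | j + 1 => 8 + 4 * (j + 2) * localConst j

theorem localConst_nonneg : ∀ j, 0 ≤ localConst j
  | 0 => le_rfl
  | j + 1 => by
    have := localConst_nonneg j
    rw [localConst]
    positivity

theorem local_poincare (he : ∀ k, Function.Involutive (e k)) (hW : ∀ x, 0 < W x)
    (hrev : ∀ k x, W (e k x) * q k (e k x) = W x * q k x) (hq : ∀ k x, 0 ≤ q k x)
    {I : Ω → ℕ} (hdown : ∀ x, I x ≠ 0 → ∃ k, I (e k x) < I x ∧ 1 / 2 ≤ q k x)
    (hup : ∀ x, ∑ k, (if I x < I (e k x) then q k x else 0) ≤ I x + 2)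
    {h : Ω → ℝ} (h0 : ∀ x, I x = 0 → h x = 0) (j : ℕ) :
    ∑ x, (if I x ≤ j then W x * h x ^ 2 else 0) ≤
      localConst j * ∑ x, W x * h x * (-moveGen e q h x) := by
  classical
  induction j with
  | zero =>
    rw [localConst, zero_mul]
    refine (Finset.sum_eq_zero fun x _ => ?_).le
    split_ifs with hx
    · rw [h0 x (by omega)]; ring
    · rfl
  | succ j ih =>
    set E := ∑ x, W x * h x * (-moveGen e q h x) with hE
    have hstep : ∀ x, (if I x ≤ j + 1 then W x * h x ^ 2 else 0) ≤
        ∑ k, (4 * (W x * q k x * (h (e k x) - h x) ^ 2) +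
          4 * (if I x ≤ j + 1 ∧ I (e k x) < I x then W x * q k x * h (e k x) ^ 2 else 0)) := by
      intro x
      have hnn : ∀ k, 0 ≤ 4 * (W x * q k x * (h (e k x) - h x) ^ 2) +
          4 * (if I x ≤ j + 1 ∧ I (e k x) < I x then W x * q k x * h (e k x) ^ 2 else 0) := by
        intro k
        have h1 := mul_nonneg (hW x).le (hq k x)
        have h2 := mul_nonneg h1 (sq_nonneg (h (e k x) - h x))
        have h3 := mul_nonneg h1 (sq_nonneg (h (e k x)))
        split_ifs <;> linarith
      by_cases hx : I x ≤ j + 1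
      · by_cases hx0 : I x = 0
        · rw [if_pos hx, h0 x hx0]
          simpa using Finset.sum_nonneg fun k _ => by simpa [h0 x hx0] using hnn k
        · obtain ⟨k, hk, hqk⟩ := hdown x hx0
          refine le_trans ?_ (Finset.single_le_sum (fun k _ => hnn k) (Finset.mem_univ k))
          rw [if_pos hx, if_pos ⟨hx, hk⟩]
          have hw := hW x
          have h1 : h x ^ 2 ≤ 2 * ((h (e k x) - h x) ^ 2 + h (e k x) ^ 2) := by
            nlinarith [sq_nonneg (h (e k x) - h x + h (e k x))]
          have h2 : W x * (2 * ((h (e k x) - h x) ^ 2 + h (e k x) ^ 2)) ≤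
              W x * (4 * q k x * ((h (e k x) - h x) ^ 2 + h (e k x) ^ 2)) := by
            refine mul_le_mul_of_nonneg_left ?_ hw.le
            refine mul_le_mul_of_nonneg_right (by linarith) (by positivity)
          nlinarith [mul_le_mul_of_nonneg_left h1 hw.le]
      · rw [if_neg hx]
        exact Finset.sum_nonneg fun k _ => hnn k
    have hsum := Finset.sum_le_sum fun x (_ : x ∈ Finset.univ) => hstep x
    rw [Finset.sum_comm] at hsum
    simp only [Finset.sum_add_distrib, ← Finset.mul_sum] at hsum
    have hE' : ∑ k, ∑ x, W x * q k x * (h (e k x) - h x) ^ 2 = 2 * E := by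
      rw [hE, moveGen_dirichlet he hrev]; ring
    rw [hE'] at hsum
    have hB : ∑ k, ∑ x, (if I x ≤ j + 1 ∧ I (e k x) < I x then W x * q k x * h (e k x) ^ 2 else 0)
        ≤ (j + 2) * ∑ x, (if I x ≤ j then W x * h x ^ 2 else 0) := by
      have h1 : ∀ k, ∑ x, (if I x ≤ j + 1 ∧ I (e k x) < I x then
          W x * q k x * h (e k x) ^ 2 else 0) =
          ∑ x, (if I (e k x) ≤ j + 1 ∧ I x < I (e k x) then W x * q k x * h x ^ 2 else 0) := by
        intro k
        rw [← sum_comp_involutive (he k)]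
        exact Finset.sum_congr rfl fun x _ => by rw [hrev, he k x]
      simp only [h1]
      rw [Finset.sum_comm, Finset.mul_sum]
      refine Finset.sum_le_sum fun x _ => ?_
      have hnn : 0 ≤ W x * h x ^ 2 := mul_nonneg (hW x).le (sq_nonneg _)
      by_cases hx : I x ≤ j
      · rw [if_pos hx]
        have h2 : ∑ k, (if I (e k x) ≤ j + 1 ∧ I x < I (e k x) then W x * q k x * h x ^ 2 else 0)
            ≤ ∑ k, (if I x < I (e k x) then q k x else 0) * (W x * h x ^ 2) := by
          refine Finset.sum_le_sum fun k _ => ?_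
          have := mul_nonneg (hq k x) hnn
          split_ifs with hA hB hB
          · exact (by ring : _ = _).le
          · exact absurd hA.2 hB
          · exact this
          · simp
        rw [← Finset.sum_mul] at h2
        refine h2.trans (mul_le_mul_of_nonneg_right ((hup x).trans ?_) hnn)
        have : (I x : ℝ) ≤ j := by exact_mod_cast hx
        linarith
      · rw [if_neg hx, mul_zero]
        refine (Finset.sum_eq_zero fun k _ => if_neg ?_).le
        omega
    have hS : (j + 2 : ℝ) * ∑ x, (if I x ≤ j then W x * h x ^ 2 else 0) ≤
        (j + 2) * (localConst j * E) := mul_le_mul_of_nonneg_left ih (by positivity)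
    rw [localConst]
    linarith

/-- Poincaré inequality from a Lyapunov function together with paths to the minimal state. -/
theorem poincare_of_lyapunov (he : ∀ k, Function.Involutive (e k)) (hW : ∀ x, 0 < W x)
    (hrev : ∀ k x, W (e k x) * q k (e k x) = W x * q k x) (hq : ∀ k x, 0 ≤ q k x)
    {I : Ω → ℕ} (hdown : ∀ x, I x ≠ 0 → ∃ k, I (e k x) < I x ∧ 1 / 2 ≤ q k x)
    (hup : ∀ x, ∑ k, (if I x < I (e k x) then q k x else 0) ≤ I x + 2)
    (hI : ∀ x y, I x = 0 → I y = 0 → x = y) {V : Ω → ℝ} (hV : ∀ x, 1 ≤ V x) {c B : ℝ}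
    (hc : 0 < c) (hB : 0 ≤ B) (hdrift : ∀ x, moveGen e q V x ≤ -c * V x + B) {J : ℕ}
    (hJ : ∀ x, V x < 2 * B / c → I x ≤ J) (F : Ω → ℝ) :
    (∑ x, W x) * (∑ x, W x * F x ^ 2) - (∑ x, W x * F x) ^ 2 ≤
      2 / c * (1 + B * localConst J) * (∑ x, W x) * ∑ x, W x * F x * (-moveGen e q F x) := by
  classical
  obtain ⟨b, hb⟩ : ∃ b, ∀ x, I x = 0 → F x = b := by
    by_cases h : ∃ g, I g = 0
    · obtain ⟨g, hg⟩ := h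
      exact ⟨F g, fun x hx => by rw [hI x g hx hg]⟩
    · exact ⟨0, fun x hx => absurd ⟨x, hx⟩ h⟩
  set h : Ω → ℝ := fun x => F x - b with hh
  have hEeq : ∑ x, W x * h x * (-moveGen e q h x) = ∑ x, W x * F x * (-moveGen e q F x) := by
    rw [moveGen_dirichlet he hrev, moveGen_dirichlet he hrev]
    simp [hh]
  have hloc := local_poincare he hW hrev hq hdown hup (h := h)
    (fun x hx => by simp [hh, hb x hx]) J
  have hlyap := lyapunov_form_le he hW hrev hq (V := V) (fun x => by linarith [hV x]) h
  rw [hEeq] at hloc hlyap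
  set E := ∑ x, W x * F x * (-moveGen e q F x)
  have hpt : ∀ x, c / 2 * (W x * h x ^ 2) ≤ W x * h x ^ 2 * (-moveGen e q V x / V x) +
      B * (if I x ≤ J then W x * h x ^ 2 else 0) := by
    intro x
    have hw : 0 ≤ W x * h x ^ 2 := mul_nonneg (hW x).le (sq_nonneg _)
    have hv : 0 < V x := by linarith [hV x]
    have hd := hdrift x
    have h1 : c - B / V x ≤ -moveGen e q V x / V x := by
      rw [le_div_iff₀ hv, sub_mul, div_mul_cancel₀ _ hv.ne']
      linarith
    have h2 := mul_le_mul_of_nonneg_left h1 hw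
    by_cases hx : V x < 2 * B / c
    · rw [if_pos (hJ x hx)]
      have : B / V x ≤ B := div_le_self hB (hV x)
      nlinarith [mul_le_mul_of_nonneg_left this hw]
    · have h3 : B / V x ≤ c / 2 := by
        rw [not_lt, div_le_iff₀ hc] at hx
        rw [div_le_iff₀ hv]; linarith
      have h4 : 0 ≤ B * (if I x ≤ J then W x * h x ^ 2 else 0) := by
        split_ifs <;> positivity
      nlinarith [mul_le_mul_of_nonneg_left h3 hw]
  have hsum := Finset.sum_le_sum fun x (_ : x ∈ Finset.univ) => hpt x
  rw [Finset.sum_add_distrib, ← Finset.mul_sum, ← Finset.mul_sum] at hsum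
  have hfin : ∑ x, W x * h x ^ 2 ≤ 2 / c * (1 + B * localConst J) * E := by
    have h1 : c / 2 * ∑ x, W x * h x ^ 2 ≤ (1 + B * localConst J) * E := by
      nlinarith [mul_le_mul_of_nonneg_left hloc hB]
    have h2 := mul_le_mul_of_nonneg_left h1 (by positivity : 0 ≤ 2 / c)
    calc _ = 2 / c * (c / 2 * ∑ x, W x * h x ^ 2) := by field_simp
      _ ≤ _ := h2
      _ = _ := by ring
  have hZ : 0 ≤ ∑ x, W x := Finset.sum_nonneg fun x _ => (hW x).le
  have hvar : (∑ x, W x) * (∑ x, W x * F x ^ 2) - (∑ x, W x * F x) ^ 2 =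
      (∑ x, W x) * (∑ x, W x * h x ^ 2) - (∑ x, W x * h x) ^ 2 := by
    rw [sum_mul_sum_sq_sub, sum_mul_sum_sq_sub]
    simp [hh]
  rw [hvar]
  nlinarith [sq_nonneg (∑ x, W x * h x), mul_le_mul_of_nonneg_left hfin hZ]

end Moves

section Words

variable {n : ℕ}

/-- The position following `i`, or `i` itself if `i` is the last position. -/
def nextPos (i : Fin n) : Fin n :=
  if h : (i : ℕ) + 1 < n then ⟨i + 1, h⟩ else i

/-- The indicator that the letter `s` lies above the level `θ` and `t` does not. -/
def crossing (θ : ℕ) (s t : Fin 3) : ℕ :=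
  if (t : ℕ) ≤ θ ∧ θ < (s : ℕ) then 1 else 0

/-- The number of inversions of `ω` that cross the level `θ`. -/
def invCount (θ : ℕ) (ω : Fin n → Fin 3) : ℕ :=
  ∑ i, ∑ j, if i < j then crossing θ (ω i) (ω j) else 0

theorem val_nextPos (i : Fin n) (h : nextPos i ≠ i) : (nextPos i : ℕ) = i + 1 := by
  unfold nextPos at *
  split_ifs at * with h1
  · rfl
  · exact absurd rfl h

theorem sum_nextPos {R : Type*} [AddCommMonoid R] (f : Fin n → Fin n → R) (hf : ∀ i, f i i = 0) :
    ∑ i, f i (nextPos i) = ∑ i : Fin n, ∑ j : Fin n, if (j : ℕ) = (i : ℕ) + 1 then f i j else 0 := by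
  refine Finset.sum_congr rfl fun i _ => ?_
  by_cases h : (i : ℕ) + 1 < n
  · rw [Finset.sum_eq_single (nextPos i)]
    · simp [nextPos, h]
    · intro j _ hj
      refine if_neg fun hj' => hj ?_
      simp [nextPos, h, Fin.ext_iff, hj']
    · simp
  · rw [nextPos, dif_neg h, hf]
    refine (Finset.sum_eq_zero fun j _ => if_neg ?_).symm
    omega

theorem crossing_le_one (θ : ℕ) (s t : Fin 3) : crossing θ s t ≤ 1 := by
  unfold crossing
  split_ifs <;> simp

theorem crossing_self (θ : ℕ) (s : Fin 3) : crossing θ s s = 0 := by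
  unfold crossing
  split_ifs <;> omega

theorem crossing_ne_zero {θ : ℕ} {s t : Fin 3} :
    crossing θ s t ≠ 0 ↔ (t : ℕ) ≤ θ ∧ θ < (s : ℕ) := by
  unfold crossing
  split_ifs <;> simp_all

theorem crossing_eq_zero_of_le {θ : ℕ} {s t : Fin 3} (h : s ≤ t) : crossing θ s t = 0 := by
  by_contra hne
  have := crossing_ne_zero.1 hne
  omega

theorem invCount_le (θ : ℕ) (ω : Fin n → Fin 3) : invCount θ ω ≤ n ^ 2 := by
  calc invCount θ ω ≤ ∑ _i : Fin n, ∑ _j : Fin n, 1 := by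
        refine Finset.sum_le_sum fun i _ => Finset.sum_le_sum fun j _ => ?_
        split_ifs
        · exact crossing_le_one ..
        · simp
    _ = n ^ 2 := by simp [sq]

theorem invCount_swap (θ : ℕ) (ω : Fin n → Fin 3) (i : Fin n) :
    invCount θ (ω ∘ Equiv.swap i (nextPos i)) + crossing θ (ω i) (ω (nextPos i)) =
      invCount θ ω + crossing θ (ω (nextPos i)) (ω i) := by
  by_cases hj : nextPos i = i
  · rw [hj]
    simp
  have hv := val_nextPos i hj
  generalize nextPos i = j at *
  have h1 : invCount θ (ω ∘ Equiv.swap i j) =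
      ∑ x, ∑ y, if Equiv.swap i j x < Equiv.swap i j y then crossing θ (ω x) (ω y) else 0 := by
    unfold invCount
    rw [← Equiv.sum_comp (Equiv.swap i j)]
    refine Finset.sum_congr rfl fun x _ => ?_
    rw [← Equiv.sum_comp (Equiv.swap i j)]
    simp
  have h2 : ∀ u v : Fin n, crossing θ (ω u) (ω v) =
      ∑ x, ∑ y, if x = u ∧ y = v then crossing θ (ω x) (ω y) else 0 := by
    intro u v
    rw [Finset.sum_eq_single u, Finset.sum_eq_single v]
    · simp
    · intro y _ hy; simp [hy]
    · simp
    · intro x _ hx; simp [hx]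
    · simp
  rw [h1, h2 i j, h2 j i, invCount]
  simp only [← Finset.sum_add_distrib]
  refine Finset.sum_congr rfl fun x _ => Finset.sum_congr rfl fun y _ => ?_
  have hlt : Equiv.swap i j x < Equiv.swap i j y ↔
      (x < y ∧ ¬ (x = i ∧ y = j)) ∨ (x = j ∧ y = i) := by
    simp only [Equiv.swap_apply_def]
    simp only [Fin.ext_iff, ← Fin.val_fin_lt] at *
    split_ifs <;> omega
  rw [if_congr hlt rfl rfl]
  by_cases ha : x = i ∧ y = j
  · obtain ⟨rfl, rfl⟩ := ha
    have : x < y := by omega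
    simp [this, Ne.symm hj]
  · by_cases hb : x = j ∧ y = i
    · obtain ⟨rfl, rfl⟩ := hb
      have : ¬ x < y := by omega
      simp [this, hj]
    · simp [ha, hb]

theorem sum_sub_nextPos (u : Fin n → ℤ) (h0 : ∀ i, 0 ≤ u i) (h1 : ∀ i, u i ≤ 1) :
    ∑ i, (u (nextPos i) - u i) ≤ 1 := by
  rcases Nat.eq_zero_or_pos n with rfl | hn
  · simp
  set f : ℕ → ℤ := fun k => u ⟨min k (n - 1), by omega⟩ with hf
  have : ∀ i : Fin n, u (nextPos i) - u i = f (i + 1) - f i := by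
    intro i
    have e1 : nextPos i = ⟨min ((i : ℕ) + 1) (n - 1), by omega⟩ := by
      unfold nextPos
      split_ifs <;> simp [Fin.ext_iff] <;> omega
    have e2 : i = ⟨min (i : ℕ) (n - 1), by omega⟩ := by
      simp [Fin.ext_iff]; omega
    rw [hf, e1]
    conv_lhs => rw [e2]
    congr 3
    simp; omega
  rw [Finset.sum_congr rfl fun i _ => this i,
    Fin.sum_univ_eq_sum_range (fun k => f (k + 1) - f k) n, Finset.sum_range_sub]
  have := h1 ⟨min n (n - 1), by omega⟩
  have := h0 ⟨min 0 (n - 1), by omega⟩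
  simp only [hf]
  omega

theorem sum_ascents_le (θ : ℕ) (ω : Fin n → Fin 3) :
    ∑ i, crossing θ (ω (nextPos i)) (ω i) ≤ ∑ i, crossing θ (ω i) (ω (nextPos i)) + 1 := by
  have := sum_sub_nextPos (fun i => if θ < (ω i : ℕ) then (1 : ℤ) else 0)
    (fun i => by split_ifs <;> simp) (fun i => by split_ifs <;> simp)
  have h2 : ∀ i, (if θ < (ω (nextPos i) : ℕ) then (1 : ℤ) else 0) -
      (if θ < (ω i : ℕ) then (1 : ℤ) else 0) =
      (crossing θ (ω (nextPos i)) (ω i) : ℤ) - (crossing θ (ω i) (ω (nextPos i)) : ℤ) := by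
    intro i
    unfold crossing
    split_ifs <;> omega
  rw [Finset.sum_congr rfl fun i _ => h2 i, Finset.sum_sub_distrib] at this
  zify
  linarith

theorem sum_descents_le (θ : ℕ) (ω : Fin n → Fin 3) :
    ∑ i, crossing θ (ω i) (ω (nextPos i)) ≤ invCount θ ω := by
  refine Finset.sum_le_sum fun i _ => ?_
  by_cases hj : nextPos i = i
  · simp [hj, crossing_self]
  · have hv := val_nextPos i hj
    have : i < nextPos i := by omega
    calc _ = (if i < nextPos i then crossing θ (ω i) (ω (nextPos i)) else 0) := by rw [if_pos this]
      _ ≤ _ := Finset.single_le_sum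
        (f := fun j => if i < j then crossing θ (ω i) (ω j) else 0)
        (fun _ _ => Nat.zero_le _) (Finset.mem_univ _)

theorem invCount_eq_zero_of_descents (θ : ℕ) (ω : Fin n → Fin 3)
    (h : ∀ i, crossing θ (ω i) (ω (nextPos i)) = 0) : invCount θ ω = 0 := by
  have key : ∀ k : ℕ, ∀ i j : Fin n, (j : ℕ) = i + k → θ < (ω i : ℕ) → θ < (ω j : ℕ) := by
    intro k
    induction k with
    | zero =>
      intro i j hij hi
      have : j = i := Fin.ext (by omega)
      rwa [this]
    | succ k ih =>
      intro i j hij hi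
      have h1 := ih i ⟨i + k, by omega⟩ rfl hi
      have h2 := h ⟨i + k, by omega⟩
      have h3 : nextPos (⟨i + k, by omega⟩ : Fin n) = j := by
        have : (i : ℕ) + k + 1 < n := by omega
        simp [nextPos, this, Fin.ext_iff]; omega
      rw [h3] at h2
      by_contra hj
      exact crossing_ne_zero.2 ⟨by omega, h1⟩ h2
  refine Finset.sum_eq_zero fun i _ => Finset.sum_eq_zero fun j _ => ?_
  split_ifs with hij
  · by_contra hne
    have h1 := crossing_ne_zero.1 hne
    have := key (j - i) i j (by have : (i : ℕ) < j := hij; omega) h1.2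
    omega
  · rfl

theorem monotone_of_invCount_eq_zero (ω : Fin n → Fin 3) (h0 : invCount 0 ω = 0)
    (h1 : invCount 1 ω = 0) : Monotone ω := by
  have hk : ∀ θ, invCount θ ω = 0 → ∀ i j, i < j → crossing θ (ω i) (ω j) = 0 := by
    intro θ h i j hij
    have := Finset.sum_eq_zero_iff.1 (Finset.sum_eq_zero_iff.1 h i (Finset.mem_univ _)) j
      (Finset.mem_univ _)
    rwa [if_pos hij] at this
  intro i j hij
  rcases hij.eq_or_lt with rfl | hlt
  · exact le_rfl
  by_contra hne
  have hne : ω j < ω i := not_le.1 hne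
  have a0 := hk 0 h0 i j hlt
  have a1 := hk 1 h1 i j hlt
  rcases Nat.eq_zero_or_pos (ω j : ℕ) with hz | hz
  · exact crossing_ne_zero.2 ⟨by omega, by omega⟩ a0
  · exact crossing_ne_zero.2 ⟨by omega, by omega⟩ a1

end Words

section WordChain

variable {n : ℕ} {num : Fin 3 → ℕ}

/-- The words of length `n` in which the letter `s` occurs `num s` times. -/
abbrev Word (n : ℕ) (num : Fin 3 → ℕ) :=
  {ω : Fin n → Fin 3 // ∀ s, #{i | ω i = s} = num s}

/-- The word `ω` with the letters at the positions `i` and `j` exchanged. -/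
def Word.swap (ω : Word n num) (i j : Fin n) : Word n num :=
  ⟨ω.1 ∘ Equiv.swap i j, fun s => by
    rw [← ω.2 s]
    refine Finset.card_bij (fun a _ => Equiv.swap i j a) (by simp)
      (fun a _ b _ h => (Equiv.swap i j).injective h) fun b hb => ⟨Equiv.swap i j b, ?_⟩
    simpa using hb⟩

/-- The probability that the adjacent letters `s`, `t` are exchanged. -/
noncomputable def swapRate (S : Fin 3 → ℝ) (s t : Fin 3) : ℝ :=
  S s / (S s + S t)

/-- The generator of the adjacent transposition chain on words. -/
noncomputable def wordGen (S : Fin 3 → ℝ) (F : Word n num → ℝ) (ω : Word n num) : ℝ :=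
  moveGen (fun i ω => ω.swap i (nextPos i))
    (fun i ω => swapRate S (ω.1 i) (ω.1 (nextPos i))) F ω

/-- The reversing weight of the adjacent transposition chain on words. -/
noncomputable def wordW (S : Fin 3 → ℝ) (ω : Word n num) : ℝ :=
  (S 0 / S 1) ^ invCount 0 ω.1 * (S 1 / S 2) ^ invCount 1 ω.1

theorem Word.swap_swap (ω : Word n num) (i j : Fin n) : (ω.swap i j).swap i j = ω := by
  apply Subtype.ext
  funext x
  simp [Word.swap]

theorem Word.ext_of_monotone (ω ω' : Word n num) (h : Monotone ω.1) (h' : Monotone ω'.1) :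
    ω = ω' := by
  have key : ∀ (u v : Word n num), Monotone u.1 → Monotone v.1 → ∀ i, v.1 i ≤ u.1 i := by
    intro u v hu hv i
    by_contra hlt
    have hlt : u.1 i < v.1 i := not_le.1 hlt
    have hcard : ∀ w : Word n num, #{j | w.1 j ≤ u.1 i} = ∑ s with s ≤ u.1 i, num s := by
      intro w
      rw [Finset.card_eq_sum_card_fiberwise (f := w.1) (t := {s | s ≤ u.1 i})
        (fun j hj => by simpa using hj)]
      refine Finset.sum_congr rfl fun s hs => ?_
      rw [← w.2 s, Finset.filter_filter]
      congr 1
      ext j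
      simp only [Finset.mem_filter, Finset.mem_univ, true_and] at *
      constructor
      · exact fun h => h.2
      · rintro rfl
        exact ⟨hs, rfl⟩
    have h1 : #{j | v.1 j ≤ u.1 i} < #{j | u.1 j ≤ u.1 i} := by
      refine Finset.card_lt_card ⟨?_, ?_⟩
      · intro j hj
        simp only [Finset.mem_filter, Finset.mem_univ, true_and] at *
        refine hu (le_of_lt ?_)
        by_contra hij
        exact absurd (hv (not_lt.1 hij)) (not_le.2 (hj.trans_lt hlt))
      · intro hs
        have := hs (show i ∈ _ by simp)
        simp only [Finset.mem_filter, Finset.mem_univ, true_and] at this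
        exact absurd this (not_le.2 hlt)
    rw [hcard u, hcard v] at h1
    exact lt_irrefl _ h1
  exact Subtype.ext (funext fun i => le_antisymm (key ω' ω h' h i) (key ω ω' h h' i))

variable {S : Fin 3 → ℝ}

theorem swapRate_nonneg (hS : ∀ s, 0 < S s) (s t : Fin 3) : 0 ≤ swapRate S s t :=
  div_nonneg (hS s).le (add_pos (hS s) (hS t)).le

theorem swapRate_le_one (hS : ∀ s, 0 < S s) (s t : Fin 3) : swapRate S s t ≤ 1 := by
  have := hS s
  have := hS t
  unfold swapRate
  rw [div_le_one (by positivity)]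
  linarith

theorem swapRate_add (hS : ∀ s, 0 < S s) (s t : Fin 3) : swapRate S s t + swapRate S t s = 1 := by
  have := hS s
  have := hS t
  unfold swapRate
  rw [add_comm (S t), ← add_div, div_self (by positivity)]

theorem wordW_pos (hS : ∀ s, 0 < S s) (ω : Word n num) : 0 < wordW S ω := by
  have := hS 0
  have := hS 1
  have := hS 2
  unfold wordW
  positivity

theorem crossing_weight (hS : ∀ s, 0 < S s) (s t : Fin 3) :
    (S 0 / S 1) ^ crossing 0 t s * (S 1 / S 2) ^ crossing 1 t s * S t =
      (S 0 / S 1) ^ crossing 0 s t * (S 1 / S 2) ^ crossing 1 s t * S s := by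
  have h0 := (hS 0).ne'
  have h1 := (hS 1).ne'
  have h2 := (hS 2).ne'
  fin_cases s <;> fin_cases t <;> simp [crossing] <;> field_simp

theorem wordW_swap (hS : ∀ s, 0 < S s) (ω : Word n num) (i : Fin n) :
    wordW S (ω.swap i (nextPos i)) * S (ω.1 (nextPos i)) = wordW S ω * S (ω.1 i) := by
  have h0 := hS 0
  have h1 := hS 1
  have h2 := hS 2
  have e0 := invCount_swap 0 ω.1 i
  have e1 := invCount_swap 1 ω.1 i
  set s := ω.1 i
  set t := ω.1 (nextPos i)
  have hw := crossing_weight hS s t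
  have hc : 0 < (S 0 / S 1) ^ crossing 0 s t * (S 1 / S 2) ^ crossing 1 s t := by positivity
  refine mul_left_cancel₀ hc.ne' ?_
  have f0 := congrArg (fun k => (S 0 / S 1) ^ k) e0
  have f1 := congrArg (fun k => (S 1 / S 2) ^ k) e1
  simp only [pow_add] at f0 f1
  have hd : wordW S (ω.swap i (nextPos i)) =
    (S 0 / S 1) ^ invCount 0 (ω.1 ∘ Equiv.swap i (nextPos i)) *
      (S 1 / S 2) ^ invCount 1 (ω.1 ∘ Equiv.swap i (nextPos i)) := rfl
  rw [hd, wordW]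
  calc _ = ((S 0 / S 1) ^ invCount 0 (ω.1 ∘ Equiv.swap i (nextPos i)) *
        (S 0 / S 1) ^ crossing 0 s t) *
      ((S 1 / S 2) ^ invCount 1 (ω.1 ∘ Equiv.swap i (nextPos i)) *
        (S 1 / S 2) ^ crossing 1 s t) * S t := by ring
    _ = (S 0 / S 1) ^ invCount 0 ω.1 * (S 1 / S 2) ^ invCount 1 ω.1 *
        ((S 0 / S 1) ^ crossing 0 t s * (S 1 / S 2) ^ crossing 1 t s * S t) := by
      rw [f0, f1]; ring
    _ = _ := by rw [hw]; ring

theorem wordW_reversible (hS : ∀ s, 0 < S s) (i : Fin n) (ω : Word n num) :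
    wordW S (ω.swap i (nextPos i)) * swapRate S ((ω.swap i (nextPos i)).1 i)
        ((ω.swap i (nextPos i)).1 (nextPos i)) =
      wordW S ω * swapRate S (ω.1 i) (ω.1 (nextPos i)) := by
  have h1 : (ω.swap i (nextPos i)).1 i = ω.1 (nextPos i) := by simp [Word.swap]
  have h2 : (ω.swap i (nextPos i)).1 (nextPos i) = ω.1 i := by simp [Word.swap]
  rw [h1, h2, swapRate, swapRate, mul_div_assoc', mul_div_assoc', wordW_swap hS, add_comm]

theorem wordGen_pow_invCount_le (hS : ∀ s, 0 < S s) {θ : ℕ} {r Q a c : ℝ} (hr : r ≤ Q)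
    (hQ : Q < 1 / 2) (hr0 : 0 ≤ r)
    (hθ : ∀ s t : Fin 3, (t : ℕ) ≤ θ → θ < (s : ℕ) → S t ≤ r * S s)
    (ha : 1 < a) (ha2 : a ≤ 2) (hQa : 2 * Q * a < 1) (hc : c = (a - 1) * (1 / a - 2 * Q) / 2)
    (ω : Word n num) :
    wordGen S (fun ω' => a ^ invCount θ ω'.1) ω ≤ -c * (a ^ invCount θ ω.1 - 1) + r := by
  set D := ∑ i, crossing θ (ω.1 i) (ω.1 (nextPos i)) with hD
  set A := ∑ i, crossing θ (ω.1 (nextPos i)) (ω.1 i) with hA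
  set I := invCount θ ω.1 with hI
  have hAD : A ≤ D + 1 := sum_ascents_le θ ω.1
  have ha0 : 0 < a := by linarith
  have hpow : 0 < a ^ I := by positivity
  have hterm : ∀ i, swapRate S (ω.1 i) (ω.1 (nextPos i)) *
      (a ^ invCount θ (ω.swap i (nextPos i)).1 - a ^ I) ≤
      a ^ I * (a - 1) / (1 + r) * (r * (crossing θ (ω.1 (nextPos i)) (ω.1 i) : ℝ) -
        (crossing θ (ω.1 i) (ω.1 (nextPos i)) : ℝ) / a) := by
    intro i
    have e := invCount_swap θ ω.1 i
    have e' : (ω.swap i (nextPos i)).1 = ω.1 ∘ Equiv.swap i (nextPos i) := rfl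
    rw [← e'] at e
    set s := ω.1 i
    set t := ω.1 (nextPos i)
    have hs := hS s
    have ht := hS t
    by_cases h1 : crossing θ s t = 0
    · by_cases h2 : crossing θ t s = 0
      · rw [h1, h2] at e ⊢
        simp only [add_zero] at e
        simp [e, hI]
      · have h2' := crossing_ne_zero.1 h2
        have h3 : crossing θ t s = 1 := by have := crossing_le_one θ t s; omega
        rw [h1, h3] at e ⊢
        have e2 : invCount θ (ω.swap i (nextPos i)).1 = I + 1 := e
        have hb := hθ t s h2'.1 h2'.2
        have hrate : swapRate S s t ≤ r / (1 + r) := by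
          unfold swapRate
          rw [div_le_div_iff₀ (by positivity) (by positivity)]
          linarith
        rw [e2]
        calc swapRate S s t * (a ^ (I + 1) - a ^ I) = swapRate S s t * (a ^ I * (a - 1)) := by ring
          _ ≤ r / (1 + r) * (a ^ I * (a - 1)) :=
            mul_le_mul_of_nonneg_right hrate (mul_nonneg hpow.le (by linarith))
          _ = _ := by push_cast; ring
    · have h1' := crossing_ne_zero.1 h1
      have h2 : crossing θ t s = 0 := crossing_eq_zero_of_le (by omega)
      have h3 : crossing θ s t = 1 := by have := crossing_le_one θ s t; omega
      rw [h2, h3] at e ⊢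
      have e2 : invCount θ (ω.swap i (nextPos i)).1 + 1 = I := e
      have hb := hθ s t h1'.1 h1'.2
      have hrate : 1 / (1 + r) ≤ swapRate S s t := by
        unfold swapRate
        rw [div_le_div_iff₀ (by positivity) (by positivity)]
        linarith
      rw [← e2]
      have hp : 0 < a ^ invCount θ (ω.swap i (nextPos i)).1 := by positivity
      generalize invCount θ (ω.swap i (nextPos i)).1 = N at *
      calc swapRate S s t * (a ^ N - a ^ (N + 1)) = -(swapRate S s t * (a ^ N * (a - 1))) := by
            ring
        _ ≤ -(1 / (1 + r) * (a ^ N * (a - 1))) :=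
          neg_le_neg (mul_le_mul_of_nonneg_right hrate (mul_nonneg hp.le (by linarith)))
        _ = _ := by push_cast; field_simp; ring
  have hsum : wordGen S (fun ω' => a ^ invCount θ ω'.1) ω ≤
      a ^ I * (a - 1) / (1 + r) * (r * A - D / a) := by
    unfold wordGen moveGen
    refine (Finset.sum_le_sum fun i _ => hterm i).trans_eq ?_
    rw [← Finset.mul_sum, Finset.sum_sub_distrib, ← Finset.mul_sum, ← Finset.sum_div, hA, hD]
    push_cast
    rfl
  refine hsum.trans ?_
  have hQ0 : 0 ≤ Q := hr0.trans hr
  have hc0 : 0 < 1 / a - 2 * Q := by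
    rw [sub_pos, lt_div_iff₀ ha0]
    exact hQa
  have hADr : (A : ℝ) ≤ D + 1 := by exact_mod_cast hAD
  by_cases hI0 : I = 0
  · have hD0 : D = 0 := by
      have := sum_descents_le θ ω.1
      omega
    rw [hD0] at hADr ⊢
    rw [hI0]
    have h1 : (a - 1) / (1 + r) ≤ 1 := by
      rw [div_le_one (by linarith)]
      linarith
    have h2 : r * (A : ℝ) ≤ r := by
      have : (A : ℝ) ≤ 1 := by simpa using hADr
      nlinarith
    have h3 : 0 ≤ (a - 1) / (1 + r) := div_nonneg (by linarith) (by linarith)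
    have h4 : 0 ≤ r * (A : ℝ) := by positivity
    simp only [pow_zero, one_mul, Nat.cast_zero, zero_div, sub_zero, sub_self, mul_zero, zero_add]
    nlinarith
  · have hD1 : 1 ≤ D := by
      rw [Nat.one_le_iff_ne_zero]
      intro h0
      exact hI0 (invCount_eq_zero_of_descents θ ω.1 fun i =>
        Finset.sum_eq_zero_iff.1 h0 i (Finset.mem_univ _))
    have hD1' : (1 : ℝ) ≤ D := by exact_mod_cast hD1
    have h1 : r * A - D / a ≤ 2 * Q - 1 / a := by
      have : r * (A : ℝ) ≤ Q * (D + 1) := mul_le_mul hr hADr (by positivity) hQ0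
      have h5 : (D : ℝ) / a = D * (1 / a) := by ring
      rw [h5]
      have h6 : 0 ≤ 1 / a - Q := by linarith
      nlinarith [mul_nonneg (sub_nonneg.2 hD1') h6]
    have h2 : (a - 1) / 2 ≤ (a - 1) / (1 + r) :=
      div_le_div_of_nonneg_left (by linarith) (by linarith) (by linarith)
    have h3 : 0 ≤ (a - 1) / (1 + r) := div_nonneg (by linarith) (by linarith)
    have h4 : a ^ I * (a - 1) / (1 + r) * (r * A - D / a) ≤ a ^ I * (-c) := by
      rw [mul_div_assoc, mul_assoc]
      refine mul_le_mul_of_nonneg_left ?_ hpow.le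
      rw [hc]
      nlinarith
    have h5 : 0 ≤ c := by
      rw [hc]
      exact div_nonneg (mul_nonneg (by linarith) hc0.le) zero_le_two
    nlinarith

theorem exists_swap_lt (hS : ∀ s, 0 < S s) (hmono : Monotone S) (ω : Word n num)
    (h : invCount 0 ω.1 + invCount 1 ω.1 ≠ 0) :
    ∃ i, invCount 0 (ω.swap i (nextPos i)).1 + invCount 1 (ω.swap i (nextPos i)).1 <
        invCount 0 ω.1 + invCount 1 ω.1 ∧
      1 / 2 ≤ swapRate S (ω.1 i) (ω.1 (nextPos i)) := by
  obtain ⟨θ, hθ, hne⟩ : ∃ θ : ℕ, (θ = 0 ∨ θ = 1) ∧ invCount θ ω.1 ≠ 0 := by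
    by_cases h0 : invCount 0 ω.1 = 0
    · exact ⟨1, Or.inr rfl, by omega⟩
    · exact ⟨0, Or.inl rfl, h0⟩
  obtain ⟨i, hi⟩ : ∃ i, crossing θ (ω.1 i) (ω.1 (nextPos i)) ≠ 0 := by
    by_contra! hall
    exact hne (invCount_eq_zero_of_descents θ ω.1 hall)
  have hc := crossing_ne_zero.1 hi
  have hlt : ω.1 (nextPos i) ≤ ω.1 i := by omega
  refine ⟨i, ?_, ?_⟩
  · have e0 := invCount_swap 0 ω.1 i
    have e1 := invCount_swap 1 ω.1 i
    rw [crossing_eq_zero_of_le hlt] at e0 e1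
    change invCount 0 (ω.1 ∘ Equiv.swap i (nextPos i)) +
      invCount 1 (ω.1 ∘ Equiv.swap i (nextPos i)) < _
    rcases hθ with rfl | rfl <;> omega
  · have h1 := hS (ω.1 i)
    have h2 := hS (ω.1 (nextPos i))
    have h3 := hmono hlt
    unfold swapRate
    rw [div_le_div_iff₀ (by norm_num) (by positivity)]
    linarith

theorem sum_up_rates_le (hS : ∀ s, 0 < S s) (ω : Word n num) :
    ∑ i, (if invCount 0 ω.1 + invCount 1 ω.1 <
        invCount 0 (ω.swap i (nextPos i)).1 + invCount 1 (ω.swap i (nextPos i)).1 then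
          swapRate S (ω.1 i) (ω.1 (nextPos i)) else 0) ≤
      ((invCount 0 ω.1 + invCount 1 ω.1 : ℕ) : ℝ) + 2 := by
  have h0 := sum_ascents_le 0 ω.1
  have h1 := sum_ascents_le 1 ω.1
  have d0 := sum_descents_le 0 ω.1
  have d1 := sum_descents_le 1 ω.1
  have hb : ∑ i, (crossing 0 (ω.1 (nextPos i)) (ω.1 i) + crossing 1 (ω.1 (nextPos i)) (ω.1 i)) ≤
      invCount 0 ω.1 + invCount 1 ω.1 + 2 := by
    rw [Finset.sum_add_distrib]
    omega
  have hb' : ((∑ i, (crossing 0 (ω.1 (nextPos i)) (ω.1 i) +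
      crossing 1 (ω.1 (nextPos i)) (ω.1 i)) : ℕ) : ℝ) ≤
      ((invCount 0 ω.1 + invCount 1 ω.1 : ℕ) : ℝ) + 2 := by exact_mod_cast hb
  refine le_trans ?_ hb'
  rw [Nat.cast_sum]
  refine Finset.sum_le_sum fun i _ => ?_
  have e0 := invCount_swap 0 ω.1 i
  have e1 := invCount_swap 1 ω.1 i
  split_ifs with h
  · change _ < invCount 0 (ω.1 ∘ Equiv.swap i (nextPos i)) +
      invCount 1 (ω.1 ∘ Equiv.swap i (nextPos i)) at h
    have : 1 ≤ crossing 0 (ω.1 (nextPos i)) (ω.1 i) + crossing 1 (ω.1 (nextPos i)) (ω.1 i) := by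
      omega
    exact (swapRate_le_one hS _ _).trans (by exact_mod_cast this)
  · positivity

theorem wordGen_add (F H : Word n num → ℝ) (ω : Word n num) :
    wordGen S (fun x => F x + H x) ω = wordGen S F ω + wordGen S H ω := by
  unfold wordGen moveGen
  rw [← Finset.sum_add_distrib]
  exact Finset.sum_congr rfl fun i _ => by ring

theorem isSystem_word (hS : ∀ s, 0 < S s) {Q a c : ℝ} (h0 : S 0 / S 1 ≤ Q) (h1 : S 1 / S 2 ≤ Q)
    (hQ : Q < 1 / 2) (ha : 1 < a) (ha2 : a ≤ 2) (hQa : 2 * Q * a < 1)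
    (hc : c = (a - 1) * (1 / a - 2 * Q) / 2) {J : ℕ} (hJ : 2 * (2 * c + 2) / c ≤ a ^ J) :
    IsSystem (2 / c * (1 + (2 * c + 2) * localConst (2 * J))) a c n 2 (n ^ 2)
      (wordW S : Word n num → ℝ) (wordGen S) := by
  have p0 := hS 0
  have p1 := hS 1
  have p2 := hS 2
  have hr0 : 0 ≤ S 0 / S 1 := by positivity
  have hr1 : 0 ≤ S 1 / S 2 := by positivity
  have l01 : S 0 = S 0 / S 1 * S 1 := by field_simp
  have l12 : S 1 = S 1 / S 2 * S 2 := by field_simp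
  have m01 : S 0 ≤ S 1 := by
    rw [l01]; nlinarith
  have m12 : S 1 ≤ S 2 := by
    conv_lhs => rw [l12]
    nlinarith
  have hmono : Monotone S := by
    intro s t hst
    fin_cases s <;> fin_cases t <;>
      first
        | exact le_rfl
        | exact m01
        | exact m12
        | exact m01.trans m12
        | exact absurd hst (by decide)
  have hc0 : 0 < c := by
    rw [hc]
    refine div_pos (mul_pos (by linarith) ?_) two_pos
    rw [sub_pos, lt_div_iff₀ (by linarith)]
    exact hQa
  have hd0 : ∀ ω : Word n num, wordGen S (fun ω' => a ^ invCount 0 ω'.1) ω ≤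
      -c * (a ^ invCount 0 ω.1 - 1) + S 0 / S 1 := by
    refine wordGen_pow_invCount_le hS h0 hQ hr0 ?_ ha ha2 hQa hc
    intro s t ht hs
    have ht0 : t = 0 := by omega
    have h1s : (1 : Fin 3) ≤ s := by omega
    rw [ht0]
    calc S 0 = S 0 / S 1 * S 1 := l01
      _ ≤ S 0 / S 1 * S s := mul_le_mul_of_nonneg_left (hmono h1s) hr0
  have hd1 : ∀ ω : Word n num, wordGen S (fun ω' => a ^ invCount 1 ω'.1) ω ≤
      -c * (a ^ invCount 1 ω.1 - 1) + S 1 / S 2 := by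
    refine wordGen_pow_invCount_le hS h1 hQ hr1 ?_ ha ha2 hQa hc
    intro s t ht hs
    have hs0 : s = 2 := by omega
    have h1s : t ≤ (1 : Fin 3) := by omega
    rw [hs0]
    exact (hmono h1s).trans_eq l12
  have hinv : ∀ i : Fin n, Function.Involutive (fun ω : Word n num => ω.swap i (nextPos i)) :=
    fun i ω => Word.swap_swap ω _ _
  have hq : ∀ (i : Fin n) (ω : Word n num), 0 ≤ swapRate S (ω.1 i) (ω.1 (nextPos i)) :=
    fun i ω => swapRate_nonneg hS _ _
  have hq1 : ∀ (i : Fin n) (ω : Word n num), swapRate S (ω.1 i) (ω.1 (nextPos i)) +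
      swapRate S ((ω.swap i (nextPos i)).1 i) ((ω.swap i (nextPos i)).1 (nextPos i)) = 1 := by
    intro i ω
    have e1 : (ω.swap i (nextPos i)).1 i = ω.1 (nextPos i) := by simp [Word.swap]
    have e2 : (ω.swap i (nextPos i)).1 (nextPos i) = ω.1 i := by simp [Word.swap]
    rw [e1, e2, swapRate_add hS]
  have hrev := fun i (ω : Word n num) => wordW_reversible hS i ω
  refine ⟨wordW_pos hS, ?_, ?_, ?_, ?_, ?_⟩
  · intro b x
    simp [wordGen, moveGen]
  · intro F H
    have e1 := moveGen_form (W := wordW S)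
      (q := fun i ω => swapRate S (ω.1 i) (ω.1 (nextPos i))) hinv hrev F H
    have e2 := moveGen_form (W := wordW S)
      (q := fun i ω => swapRate S (ω.1 i) (ω.1 (nextPos i))) hinv hrev H F
    simp only [wordGen]
    rw [e1, e2]
    congr 2
    exact Finset.sum_congr rfl fun k _ => Finset.sum_congr rfl fun x _ => by ring
  · refine poincare_of_lyapunov hinv (wordW_pos hS) hrev hq
      (I := fun ω => invCount 0 ω.1 + invCount 1 ω.1)
      (V := fun ω => a ^ invCount 0 ω.1 + a ^ invCount 1 ω.1)
      (exists_swap_lt hS hmono) (sum_up_rates_le hS) ?_ ?_ hc0 (by linarith) ?_ ?_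
    · intro x y hx hy
      exact Word.ext_of_monotone x y
        (monotone_of_invCount_eq_zero _ (by omega) (by omega))
        (monotone_of_invCount_eq_zero _ (by omega) (by omega))
    · intro x
      have := one_le_pow₀ ha.le (n := invCount 0 x.1)
      have := one_le_pow₀ ha.le (n := invCount 1 x.1)
      linarith
    · intro x
      have e := wordGen_add (S := S) (fun ω : Word n num => a ^ invCount 0 ω.1)
        (fun ω => a ^ invCount 1 ω.1) x
      have e0 := hd0 x
      have e1 := hd1 x
      change wordGen S (fun ω : Word n num => a ^ invCount 0 ω.1 + a ^ invCount 1 ω.1) x ≤ _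
      rw [e]
      linarith
    · intro x hx
      have a0 : 0 < a ^ invCount 0 x.1 := by positivity
      have a1 : 0 < a ^ invCount 1 x.1 := by positivity
      have b0 : invCount 0 x.1 < J := (pow_lt_pow_iff_right₀ ha).1 (by linarith)
      have b1 : invCount 1 x.1 < J := (pow_lt_pow_iff_right₀ ha).1 (by linarith)
      omega
  · intro F
    have h := moveGen_dirichlet_le hinv (wordW_pos hS) hrev hq hq1 F
    rwa [Fintype.card_fin] at h
  · refine ⟨[(S 0 / S 1, fun ω => invCount 0 ω.1), (S 1 / S 2, fun ω => invCount 1 ω.1)],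
      le_rfl, fun x => by simp [wordW], ?_⟩
    intro o ho
    simp only [List.mem_cons, List.not_mem_nil, or_false] at ho
    rcases ho with rfl | rfl
    · exact ⟨by positivity, by linarith, fun x => invCount_le _ _, hd0⟩
    · exact ⟨by positivity, by linarith, fun x => invCount_le _ _, hd1⟩

end WordChain

section Glue

variable {n : ℕ} {num : Fin 3 → ℕ}

namespace Word

/-- The increasing enumeration of the positions of the letter `s` in `ω`. -/
def emb (ω : Word n num) (s : Fin 3) : Fin (num s) ↪o Fin n :=
  Finset.orderEmbOfFin _ (ω.2 s)

@[simp]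
theorem apply_emb (ω : Word n num) (s : Fin 3) (k : Fin (num s)) : ω.1 (ω.emb s k) = s := by
  exact (Finset.mem_filter.1 (Finset.orderEmbOfFin_mem _ (ω.2 s) k)).2

theorem exists_emb (ω : Word n num) (i : Fin n) : ∃ s k, ω.emb s k = i := by
  have h : i ∈ Set.range (ω.emb (ω.1 i)) := by
    rw [emb, Finset.range_orderEmbOfFin]
    simp
  exact ⟨ω.1 i, h⟩

/-- The positions of a word, grouped by their letters. -/
noncomputable def posEquiv (ω : Word n num) : (Σ s, Fin (num s)) ≃ Fin n :=
  Equiv.ofBijective (fun x => ω.emb x.1 x.2) <| by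
    constructor
    · rintro ⟨s, k⟩ ⟨t, m⟩ h
      have h' : ω.emb s k = ω.emb t m := h
      have hst : s = t := by
        rw [← ω.apply_emb s k, h', ω.apply_emb]
      subst hst
      rw [(ω.emb s).injective h']
    · intro i
      obtain ⟨s, k, h⟩ := ω.exists_emb i
      exact ⟨⟨s, k⟩, h⟩

theorem posEquiv_apply (ω : Word n num) (s : Fin 3) (k : Fin (num s)) :
    ω.posEquiv ⟨s, k⟩ = ω.emb s k := rfl

@[to_additive]
theorem prod_emb {M : Type*} [CommMonoid M] (ω : Word n num) (f : Fin n → M) :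
    ∏ i, f i = ∏ s, ∏ k, f (ω.emb s k) := by
  rw [← Equiv.prod_comp ω.posEquiv, Fintype.prod_sigma]
  rfl

@[to_additive]
theorem prod_prod_emb {M : Type*} [CommMonoid M] (ω : Word n num) (f : Fin n → Fin n → M) :
    ∏ i, ∏ j, f i j = (∏ i, ∏ j, if ω.1 i ≠ ω.1 j then f i j else 1) *
      ∏ s, ∏ k, ∏ k', f (ω.emb s k) (ω.emb s k') := by
  have h1 : ∏ i, ∏ j, f i j = (∏ i, ∏ j, if ω.1 i ≠ ω.1 j then f i j else 1) *
      ∏ i, ∏ j, if ω.1 i = ω.1 j then f i j else 1 := by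
    simp only [← Finset.prod_mul_distrib]
    refine Finset.prod_congr rfl fun i _ => Finset.prod_congr rfl fun j _ => ?_
    by_cases h : ω.1 i = ω.1 j <;> simp [h]
  rw [h1, ω.prod_emb (fun i => ∏ j, if ω.1 i = ω.1 j then f i j else 1)]
  congr 1
  refine Finset.prod_congr rfl fun s _ => Finset.prod_congr rfl fun k _ => ?_
  rw [ω.prod_emb, Finset.prod_eq_single s]
  · simp
  · intro t _ ht
    refine Finset.prod_eq_one fun m _ => if_neg ?_
    simpa using Ne.symm ht
  · simp

theorem emb_swap (ω : Word n num) {i j : Fin n} (hij : (j : ℕ) = i + 1) (hne : ω.1 i ≠ ω.1 j)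
    (s : Fin 3) (k : Fin (num s)) : (ω.swap i j).emb s k = Equiv.swap i j (ω.emb s k) := by
  have h : (fun k => Equiv.swap i j (ω.emb s k)) =
      Finset.orderEmbOfFin _ ((ω.swap i j).2 s) := by
    refine Finset.orderEmbOfFin_unique _ (fun k => ?_) fun k k' hk => ?_
    · refine Finset.mem_filter.2 ⟨Finset.mem_univ _, ?_⟩
      simp [Word.swap]
    · have hlt := (ω.emb s).strictMono hk
      have h1 := ω.apply_emb s k
      have h2 := ω.apply_emb s k'
      have hcase : ¬ (ω.emb s k = i ∧ ω.emb s k' = j) := by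
        rintro ⟨rfl, rfl⟩
        exact hne (h1.trans h2.symm)
      simp only [Equiv.swap_apply_def]
      simp only [Fin.ext_iff, ← Fin.val_fin_lt] at *
      split_ifs <;> omega
  exact (congrFun h k).symm

/-- The permutation whose entries with letter `s` follow `ρ s` and are placed at the positions
of the letter `s` in `ω`. -/
noncomputable def glue (L : (Σ s, Fin (num s)) ≃ Fin n) (ω : Word n num)
    (ρ : ∀ s, Equiv.Perm (Fin (num s))) : Equiv.Perm (Fin n) :=
  ω.posEquiv.symm.trans ((Equiv.sigmaCongrRight ρ).trans L)

variable (L : (Σ s, Fin (num s)) ≃ Fin n)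

@[simp]
theorem glue_emb (ω : Word n num) (ρ : ∀ s, Equiv.Perm (Fin (num s))) (s : Fin 3)
    (k : Fin (num s)) : glue L ω ρ (ω.emb s k) = L ⟨s, ρ s k⟩ := by
  rw [← posEquiv_apply]
  simp [glue]

theorem letter_glue (ω : Word n num) (ρ : ∀ s, Equiv.Perm (Fin (num s))) (i : Fin n) :
    (L.symm (glue L ω ρ i)).1 = ω.1 i := by
  obtain ⟨s, k, rfl⟩ := ω.exists_emb i
  simp

theorem eq_glue (ω : Word n num) (ρ : ∀ s, Equiv.Perm (Fin (num s))) (σ : Equiv.Perm (Fin n))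
    (h : ∀ s k, σ (ω.emb s k) = L ⟨s, ρ s k⟩) : σ = glue L ω ρ := by
  refine Equiv.ext fun i => ?_
  obtain ⟨s, k, rfl⟩ := ω.exists_emb i
  rw [h, glue_emb]

theorem glue_bijective : Function.Bijective
    (fun x : Word n num × (∀ s, Equiv.Perm (Fin (num s))) => glue L x.1 x.2) := by
  constructor
  · rintro ⟨ω, ρ⟩ ⟨ω', ρ'⟩ h
    have h' : glue L ω ρ = glue L ω' ρ' := h
    have hω : ω = ω' := Subtype.ext (funext fun i => by
      rw [← letter_glue L ω ρ i, h', letter_glue])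
    subst hω
    have hρ : ρ = ρ' := by
      funext s
      refine Equiv.ext fun k => ?_
      have := congrArg (fun σ => σ (ω.emb s k)) h'
      simpa using this
    rw [hρ]
  · intro σ
    have hcard : ∀ s, #{i | (L.symm (σ i)).1 = s} = num s := by
      intro s
      rw [← Fintype.card_fin (num s), ← Finset.card_univ]
      refine (Finset.card_bij (fun (k : Fin (num s)) _ => σ.symm (L ⟨s, k⟩)) ?_ ?_ ?_).symm
      · simp
      · intro a _ b _ h
        simpa using h
      · intro i hi
        simp only [Finset.mem_filter, Finset.mem_univ, true_and] at hi
        subst hi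
        exact ⟨(L.symm (σ i)).2, Finset.mem_univ _, by simp⟩
    set ω : Word n num := ⟨fun i => (L.symm (σ i)).1, hcard⟩ with hω
    have hex : ∀ s k, ∃ m, σ (ω.emb s k) = L ⟨s, m⟩ := by
      intro s k
      have h : (L.symm (σ (ω.emb s k))).1 = s := ω.apply_emb s k
      generalize hx : L.symm (σ (ω.emb s k)) = x at h
      obtain ⟨t, m⟩ := x
      have h' : t = s := h
      subst h'
      exact ⟨m, by rw [← hx]; simp⟩
    choose ρ hρ using hex
    have hinj : ∀ s, Function.Injective (ρ s) := by
      intro s k k' hk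
      have : σ (ω.emb s k) = σ (ω.emb s k') := by rw [hρ, hρ, hk]
      exact (ω.emb s).injective (σ.injective this)
    exact ⟨⟨ω, fun s => Equiv.ofBijective (ρ s) (Finite.injective_iff_bijective.1 (hinj s))⟩,
      (eq_glue L ω _ σ hρ).symm⟩

/-- Permutations are words together with a permutation for every letter. -/
noncomputable def glueEquiv :
    Word n num × (∀ s, Equiv.Perm (Fin (num s))) ≃ Equiv.Perm (Fin n) :=
  Equiv.ofBijective _ (glue_bijective L)

@[simp]
theorem glueEquiv_apply (x : Word n num × (∀ s, Equiv.Perm (Fin (num s)))) :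
    glueEquiv L x = glue L x.1 x.2 := rfl

theorem glue_mul_swap_of_ne (ω : Word n num) (ρ : ∀ s, Equiv.Perm (Fin (num s))) {i j : Fin n}
    (hij : (j : ℕ) = i + 1) (hne : ω.1 i ≠ ω.1 j) :
    glue L ω ρ * Equiv.swap i j = glue L (ω.swap i j) ρ := by
  refine eq_glue L _ _ _ fun s k => ?_
  rw [emb_swap ω hij hne, Equiv.Perm.mul_apply, Equiv.swap_apply_self, glue_emb]

theorem glue_mul_swap_emb (ω : Word n num) (ρ : ∀ s, Equiv.Perm (Fin (num s))) (s : Fin 3)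
    (k k' : Fin (num s)) : glue L ω ρ * Equiv.swap (ω.emb s k) (ω.emb s k') =
      glue L ω (Function.update ρ s (ρ s * Equiv.swap k k')) := by
  refine eq_glue L _ _ _ fun t m => ?_
  rw [Equiv.Perm.mul_apply]
  rcases eq_or_ne t s with rfl | hts
  · rw [(ω.emb t).injective.swap_apply k k' m, glue_emb]
    simp
  · have hne : ∀ l, ω.emb t m ≠ ω.emb s l := by
      intro l h
      have := congrArg ω.1 h
      simp only [apply_emb] at this
      exact hts this
    rw [Equiv.swap_apply_of_ne_of_ne (hne k) (hne k'), glue_emb, Function.update_of_ne hts]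

end Word

theorem wordW_eq_prod (S : Fin 3 → ℝ) (hS : ∀ s, 0 < S s) (ω : Word n num) :
    wordW S ω = ∏ i, ∏ j, if ω.1 i < ω.1 j ∧ j < i then S (ω.1 i) / S (ω.1 j) else 1 := by
  have h0 := (hS 0).ne'
  have h1 := (hS 1).ne'
  have h2 := (hS 2).ne'
  rw [wordW, invCount, invCount, Finset.prod_comm]
  simp only [← Finset.prod_pow_eq_pow_sum, ← Finset.prod_mul_distrib]
  refine Finset.prod_congr rfl fun i _ => Finset.prod_congr rfl fun j _ => ?_
  by_cases hij : i < j
  · simp only [hij, if_true, and_true]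
    generalize ω.1 i = s
    generalize ω.1 j = t
    fin_cases s <;> fin_cases t <;> simp [crossing]
    field_simp
  · simp [hij]

end Glue

section Node

variable (sL sC sR : ℝ) (l c r : STree)

theorem numLeaves_pos : ∀ T : STree, 0 < T.numLeaves
  | .leaf => one_pos
  | .node _ _ _ l _ _ => by
    have := numLeaves_pos l
    simp only [STree.numLeaves]
    omega

/-- The child subtrees of a node, indexed by their slots. -/
def kids : Fin 3 → STree := ![l, c, r]

/-- The label of the first leaf in each slot of a node. -/
def kidOffset : Fin 3 → ℕ := ![0, l.numLeaves, l.numLeaves + c.numLeaves]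

/-- The strengths of a node, indexed by its slots. -/
def kidStrength : Fin 3 → ℝ := ![sL, sC, sR]

theorem kidOffset_add_lt (s : Fin 3) {k : ℕ} (hk : k < (kids l c r s).numLeaves) :
    kidOffset l c s + k < (STree.node sL sC sR l c r).numLeaves := by
  fin_cases s <;> simp [kids, kidOffset, STree.numLeaves] at * <;> omega

theorem kidOffset_add_lt_of_lt {s t : Fin 3} (hst : s < t) {k : ℕ}
    (hk : k < (kids l c r s).numLeaves) : kidOffset l c s + k < kidOffset l c t := by
  fin_cases s <;> fin_cases t <;> simp [kids, kidOffset] at * <;> omega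

theorem eq_of_kidOffset_add_eq {s t : Fin 3} {k m : ℕ} (hk : k < (kids l c r s).numLeaves)
    (hm : m < (kids l c r t).numLeaves) (h : kidOffset l c s + k = kidOffset l c t + m) :
    s = t := by
  rcases lt_trichotomy s t with hst | hst | hst
  · have := kidOffset_add_lt_of_lt l c r hst hk
    omega
  · exact hst
  · have := kidOffset_add_lt_of_lt l c r hst hm
    omega

/-- The leaves of a node, grouped by their slots. -/
noncomputable def leafEquiv :
    (Σ s, Fin (kids l c r s).numLeaves) ≃ Fin (STree.node sL sC sR l c r).numLeaves :=
  Equiv.ofBijective (fun x => ⟨kidOffset l c x.1 + x.2, kidOffset_add_lt sL sC sR l c r x.1 x.2.2⟩)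
    <| by
    refine (Fintype.bijective_iff_injective_and_card _).2 ⟨?_, ?_⟩
    · rintro ⟨s, k⟩ ⟨t, m⟩ h
      have h' : kidOffset l c s + k = kidOffset l c t + m := congrArg Fin.val h
      have hst := eq_of_kidOffset_add_eq l c r k.2 m.2 h'
      subst hst
      rw [Fin.ext (show (k : ℕ) = m by omega)]
    · rw [Fintype.card_sigma, Fintype.card_fin, Finset.sum_congr rfl fun s _ => Fintype.card_fin _]
      simp [Fin.sum_univ_three, kids, STree.numLeaves]

@[simp]
theorem val_leafEquiv (s : Fin 3) (k : Fin (kids l c r s).numLeaves) :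
    (leafEquiv sL sC sR l c r ⟨s, k⟩ : ℕ) = kidOffset l c s + k := rfl

theorem pSwap_same (s : Fin 3) {a b : ℕ} (ha : a < (kids l c r s).numLeaves)
    (hb : b < (kids l c r s).numLeaves) :
    (STree.node sL sC sR l c r).pSwap (kidOffset l c s + a) (kidOffset l c s + b) =
      (kids l c r s).pSwap a b := by
  fin_cases s
  · simp [kids, kidOffset, STree.pSwap] at *
    simp [hb]
  · simp [kids, kidOffset, STree.pSwap] at *
    simp [hb]
  · simp [kids, kidOffset, STree.pSwap] at *
    have e : ∀ x, l.numLeaves + c.numLeaves + x - l.numLeaves - c.numLeaves = x := by omega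
    rw [e, e, if_neg (by omega), if_neg (by omega)]

theorem pSwap_cross {s t : Fin 3} (hst : s < t) {a b : ℕ} (ha : a < (kids l c r s).numLeaves)
    (hb : b < (kids l c r t).numLeaves) :
    (STree.node sL sC sR l c r).pSwap (kidOffset l c s + a) (kidOffset l c t + b) =
      kidStrength sL sC sR t / (kidStrength sL sC sR t + kidStrength sL sC sR s) := by
  fin_cases s <;> fin_cases t <;> simp [kids, kidOffset, kidStrength, STree.pSwap] at * <;>
    split_ifs <;> first | rfl | omega

theorem lcaRange_same (s : Fin 3) {a b : ℕ} (ha : a < (kids l c r s).numLeaves)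
    (hb : b < (kids l c r s).numLeaves) :
    (STree.node sL sC sR l c r).lcaRange (kidOffset l c s + a) (kidOffset l c s + b) =
      (kidOffset l c s + ((kids l c r s).lcaRange a b).1,
        kidOffset l c s + ((kids l c r s).lcaRange a b).2) := by
  fin_cases s
  · simp [kids, kidOffset, STree.lcaRange] at *
    simp [hb]
  · simp [kids, kidOffset, STree.lcaRange] at *
    simp [hb, add_comm]
  · simp [kids, kidOffset, STree.lcaRange] at *
    have e : ∀ x, l.numLeaves + c.numLeaves + x - l.numLeaves - c.numLeaves = x := by omega
    rw [e, e, if_neg (by omega)]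
    ext <;> simp <;> omega

theorem lcaRange_cross {s t : Fin 3} (hst : s < t) {a b : ℕ} (ha : a < (kids l c r s).numLeaves)
    (hb : b < (kids l c r t).numLeaves) :
    (STree.node sL sC sR l c r).lcaRange (kidOffset l c s + a) (kidOffset l c t + b) =
      (0, (STree.node sL sC sR l c r).numLeaves - 1) := by
  fin_cases s <;> fin_cases t <;> simp [kids, kidOffset, STree.lcaRange, STree.numLeaves] at * <;>
    split_ifs <;> first | rfl | omega

theorem lcaRange_snd_lt : ∀ (T : STree) (a b : ℕ), b < T.numLeaves →
    (T.lcaRange a b).2 < T.numLeaves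
  | .leaf, _, _, _ => one_pos
  | .node _ _ _ l c r, a, b, hb => by
    have hl := numLeaves_pos l
    simp only [STree.numLeaves] at hb ⊢
    unfold STree.lcaRange
    split_ifs with h1 h2 h3
    · have := lcaRange_snd_lt l a b h1
      omega
    · have := lcaRange_snd_lt c (a - l.numLeaves) (b - l.numLeaves) (by omega)
      simp only
      omega
    · have := lcaRange_snd_lt r (a - l.numLeaves - c.numLeaves) (b - l.numLeaves - c.numLeaves)
        (by omega)
      simp only
      omega
    · simp only
      omega

end Node

theorem Word.swap_of_eq {n : ℕ} {num : Fin 3 → ℕ} (ω : Word n num) {i j : Fin n}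
    (h : ω.1 i = ω.1 j) : ω.swap i j = ω := by
  apply Subtype.ext
  funext x
  simp only [Word.swap, Function.comp_apply, Equiv.swap_apply_def]
  split_ifs with h1 h2
  · rw [h1, h]
  · rw [h2, h]
  · rfl

section Generator

/-- The probability that an allowed choice of positions carrying `u`, `v` exchanges them. -/
noncomputable def swapProb (T : STree) (u v : ℕ) : ℝ :=
  if u ≤ v then 1 - T.pSwap (min u v) (max u v) else T.pSwap (min u v) (max u v)

/-- No position strictly between `i` and `j` carries a leaf of the subtree that is rooted at the
lowest common ancestor of the leaves at `i` and `j`. -/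
def Free (T : STree) (σ : Equiv.Perm (Fin T.numLeaves)) (i j : Fin T.numLeaves) : Prop :=
  ∀ l, i < l → l < j →
    ¬((T.lcaRange (min (σ i : ℕ) (σ j : ℕ)) (max (σ i : ℕ) (σ j : ℕ))).1 ≤ (σ l : ℕ) ∧
      (σ l : ℕ) ≤ (T.lcaRange (min (σ i : ℕ) (σ j : ℕ)) (max (σ i : ℕ) (σ j : ℕ))).2)

instance (T : STree) (σ : Equiv.Perm (Fin T.numLeaves)) (i j : Fin T.numLeaves) :
    Decidable (Free T σ i j) := by
  unfold Free
  infer_instance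

/-- The generator of `M_tree`, sped up by the number of pairs of positions. -/
noncomputable def treeGen (T : STree) (F : Equiv.Perm (Fin T.numLeaves) → ℝ)
    (σ : Equiv.Perm (Fin T.numLeaves)) : ℝ :=
  ∑ i, ∑ j, if i < j ∧ Free T σ i j then
    swapProb T (σ i) (σ j) * (F (σ * Equiv.swap i j) - F σ) else 0

variable {sL sC sR : ℝ} {l c r : STree}

theorem swapProb_same (s : Fin 3) {a b : ℕ} (ha : a < (kids l c r s).numLeaves)
    (hb : b < (kids l c r s).numLeaves) :
    swapProb (STree.node sL sC sR l c r) (kidOffset l c s + a) (kidOffset l c s + b) =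
      swapProb (kids l c r s) a b := by
  unfold swapProb
  rw [min_add_add_left, max_add_add_left, pSwap_same _ _ _ _ _ _ _ (min_lt_of_left_lt ha)
    (max_lt ha hb)]
  simp

theorem swapProb_cross (hS : ∀ s, 0 < kidStrength sL sC sR s) {s t : Fin 3} (hst : s ≠ t)
    {a b : ℕ} (ha : a < (kids l c r s).numLeaves) (hb : b < (kids l c r t).numLeaves) :
    swapProb (STree.node sL sC sR l c r) (kidOffset l c s + a) (kidOffset l c t + b) =
      swapRate (kidStrength sL sC sR) s t := by
  unfold swapProb swapRate
  have h1 := hS s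
  have h2 := hS t
  rcases lt_or_gt_of_ne hst with h | h
  · have hlt := kidOffset_add_lt_of_lt l c r h ha
    rw [if_pos (by omega), min_eq_left (by omega), max_eq_right (by omega),
      pSwap_cross _ _ _ _ _ _ h ha hb, eq_div_iff (by positivity), sub_mul, one_mul, add_comm,
      div_mul_cancel₀ _ (by positivity)]
    ring
  · have hlt := kidOffset_add_lt_of_lt l c r h hb
    rw [if_neg (by omega), min_eq_right (by omega), max_eq_left (by omega),
      pSwap_cross _ _ _ _ _ _ h hb ha]

theorem lcaRange_min_max_cross {s t : Fin 3} (hst : s ≠ t)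
    {a b : ℕ} (ha : a < (kids l c r s).numLeaves) (hb : b < (kids l c r t).numLeaves) :
    (STree.node sL sC sR l c r).lcaRange (min (kidOffset l c s + a) (kidOffset l c t + b))
      (max (kidOffset l c s + a) (kidOffset l c t + b)) =
      (0, (STree.node sL sC sR l c r).numLeaves - 1) := by
  rcases lt_or_gt_of_ne hst with h | h
  · have hlt := kidOffset_add_lt_of_lt l c r h ha
    rw [min_eq_left (by omega), max_eq_right (by omega), lcaRange_cross _ _ _ _ _ _ h ha hb]
  · have hlt := kidOffset_add_lt_of_lt l c r h hb
    rw [min_eq_right (by omega), max_eq_left (by omega), lcaRange_cross _ _ _ _ _ _ h hb ha]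

variable (ω : Word (STree.node sL sC sR l c r).numLeaves fun s => (kids l c r s).numLeaves)
  (ρ : ∀ s, Equiv.Perm (Fin (kids l c r s).numLeaves))

/-- The permutation of the leaves of a node with slot pattern `ω` and child patterns `ρ`. -/
noncomputable abbrev nodeGlue : Equiv.Perm (Fin (STree.node sL sC sR l c r).numLeaves) :=
  Word.glue (leafEquiv sL sC sR l c r) ω ρ

theorem val_nodeGlue_emb (s : Fin 3) (k : Fin (kids l c r s).numLeaves) :
    (nodeGlue ω ρ (ω.emb s k) : ℕ) = kidOffset l c s + ρ s k := by
  rw [Word.glue_emb, val_leafEquiv]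

theorem free_of_ne {i j : Fin (STree.node sL sC sR l c r).numLeaves} (hne : ω.1 i ≠ ω.1 j)
    (hij : i < j) : Free _ (nodeGlue ω ρ) i j ↔ (j : ℕ) = i + 1 := by
  have hrange : (STree.node sL sC sR l c r).lcaRange
      (min (nodeGlue ω ρ i : ℕ) (nodeGlue ω ρ j : ℕ))
      (max (nodeGlue ω ρ i : ℕ) (nodeGlue ω ρ j : ℕ)) =
      (0, (STree.node sL sC sR l c r).numLeaves - 1) := by
    obtain ⟨s, k, rfl⟩ := ω.exists_emb i
    obtain ⟨t, m, rfl⟩ := ω.exists_emb j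
    rw [Word.apply_emb, Word.apply_emb] at hne
    rw [val_nodeGlue_emb, val_nodeGlue_emb, lcaRange_min_max_cross hne (Fin.is_lt _) (Fin.is_lt _)]
  unfold Free
  rw [hrange]
  constructor
  · intro h
    by_contra hj
    have hlt : (i : ℕ) < j := hij
    have hl : (i : ℕ) + 1 < (STree.node sL sC sR l c r).numLeaves := by omega
    refine h ⟨i + 1, hl⟩ (by rw [← Fin.val_fin_lt]; simp) (by rw [← Fin.val_fin_lt]; simp; omega)
      ⟨Nat.zero_le _, ?_⟩
    have := (nodeGlue ω ρ ⟨i + 1, hl⟩).2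
    simp only
    omega
  · intro hj x hx hx'
    rw [← Fin.val_fin_lt] at hx hx'
    omega

theorem free_emb (s : Fin 3) (k k' : Fin (kids l c r s).numLeaves) :
    Free _ (nodeGlue ω ρ) (ω.emb s k) (ω.emb s k') ↔ Free _ (ρ s) k k' := by
  unfold Free
  rw [val_nodeGlue_emb, val_nodeGlue_emb, min_add_add_left, max_add_add_left,
    lcaRange_same _ _ _ _ _ _ _ (min_lt_of_left_lt (Fin.is_lt _))
    (max_lt (Fin.is_lt _) (Fin.is_lt _))]
  have hlt := lcaRange_snd_lt (kids l c r s) (min (ρ s k : ℕ) (ρ s k')) (max (ρ s k : ℕ) (ρ s k'))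
    (max_lt (Fin.is_lt _) (Fin.is_lt _))
  generalize (kids l c r s).lcaRange (min (ρ s k : ℕ) (ρ s k')) (max (ρ s k : ℕ) (ρ s k')) = R at *
  constructor
  · intro h m hm hm' hR
    refine h (ω.emb s m) ((ω.emb s).lt_iff_lt.2 hm) ((ω.emb s).lt_iff_lt.2 hm') ?_
    rw [val_nodeGlue_emb]
    simp only
    omega
  · intro h x hx hx' hR
    obtain ⟨t, m, rfl⟩ := ω.exists_emb x
    rw [val_nodeGlue_emb] at hR
    simp only at hR
    have hst : t = s := eq_of_kidOffset_add_eq l c r (k := ρ t m)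
      (m := kidOffset l c t + ρ t m - kidOffset l c s) (Fin.is_lt _) (by omega) (by omega)
    subst hst
    exact h m ((ω.emb t).lt_iff_lt.1 hx) ((ω.emb t).lt_iff_lt.1 hx') (by omega)

theorem treeGen_nodeGlue (hS : ∀ s, 0 < kidStrength sL sC sR s)
    (F : Equiv.Perm (Fin (STree.node sL sC sR l c r).numLeaves) → ℝ) :
    treeGen _ F (nodeGlue ω ρ) =
      wordGen (kidStrength sL sC sR) (fun ω' => F (nodeGlue ω' ρ)) ω +
      piGen (fun s => treeGen (kids l c r s)) (fun ρ' => F (nodeGlue ω ρ')) ρ := by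
  unfold treeGen
  rw [ω.sum_sum_emb]
  congr 1
  · have h := sum_nextPos (fun i j => swapRate (kidStrength sL sC sR) (ω.1 i) (ω.1 j) *
      (F (nodeGlue (ω.swap i j) ρ) - F (nodeGlue ω ρ))) (fun i => by
        rw [ω.swap_of_eq rfl]; simp)
    refine Eq.trans ?_ h.symm
    refine Finset.sum_congr rfl fun i _ => Finset.sum_congr rfl fun j _ => ?_
    by_cases hne : ω.1 i = ω.1 j
    · rw [ω.swap_of_eq hne]
      simp [hne]
    · rw [if_pos hne]
      by_cases hij : (j : ℕ) = i + 1
      · have hlt : i < j := by rw [← Fin.val_fin_lt]; omega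
        rw [if_pos ⟨hlt, (free_of_ne ω ρ hne hlt).2 hij⟩, if_pos hij,
          Word.glue_mul_swap_of_ne _ ω ρ hij hne]
        congr 1
        obtain ⟨s, k, rfl⟩ := ω.exists_emb i
        obtain ⟨t, m, rfl⟩ := ω.exists_emb j
        rw [Word.apply_emb, Word.apply_emb] at hne ⊢
        rw [val_nodeGlue_emb, val_nodeGlue_emb, swapProb_cross hS hne (Fin.is_lt _) (Fin.is_lt _)]
      · rw [if_neg hij, if_neg]
        rintro ⟨h1, h2⟩
        exact hij ((free_of_ne ω ρ hne h1).1 h2)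
  · refine Finset.sum_congr rfl fun s _ => Finset.sum_congr rfl fun k _ =>
      Finset.sum_congr rfl fun k' _ => ?_
    rw [if_congr (and_congr (ω.emb s).lt_iff_lt (free_emb ω ρ s k k')) rfl rfl,
      val_nodeGlue_emb, val_nodeGlue_emb, swapProb_same s (Fin.is_lt _) (Fin.is_lt _),
      Word.glue_mul_swap_emb]
    beta_reduce
    rw [Function.update_eq_self]

/-- The factor of the stationary weight for leaves `u < v` in reverse order. -/
noncomputable def oddsRatio (T : STree) (u v : ℕ) : ℝ :=
  (1 - T.pSwap u v) / T.pSwap u v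

theorem treeW_eq_prod (T : STree) (σ : Equiv.Perm (Fin T.numLeaves)) :
    treeW T σ = ∏ i, ∏ j, if σ i < σ j ∧ j < i then oddsRatio T (σ i) (σ j) else 1 := by
  unfold treeW
  rw [← Equiv.prod_comp σ]
  refine Finset.prod_congr rfl fun i _ => ?_
  rw [← Equiv.prod_comp σ]
  simp [oddsRatio]

theorem treeW_nodeGlue (hS : ∀ s, 0 < kidStrength sL sC sR s) :
    treeW _ (nodeGlue ω ρ) =
      wordW (kidStrength sL sC sR) ω * ∏ s, treeW (kids l c r s) (ρ s) := by
  rw [treeW_eq_prod, ω.prod_prod_emb, wordW_eq_prod _ hS]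
  congr 1
  · refine Finset.prod_congr rfl fun i _ => Finset.prod_congr rfl fun j _ => ?_
    by_cases hne : ω.1 i = ω.1 j
    · simp [hne]
    rw [if_pos hne]
    have hlt : nodeGlue ω ρ i < nodeGlue ω ρ j ↔ ω.1 i < ω.1 j := by
      obtain ⟨s, k, rfl⟩ := ω.exists_emb i
      obtain ⟨t, m, rfl⟩ := ω.exists_emb j
      rw [Word.apply_emb, Word.apply_emb] at hne ⊢
      rw [← Fin.val_fin_lt, val_nodeGlue_emb, val_nodeGlue_emb]
      rcases lt_or_gt_of_ne hne with h | h
      · have := kidOffset_add_lt_of_lt l c r h (ρ s k).2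
        simp only [h, iff_true]
        omega
      · have := kidOffset_add_lt_of_lt l c r h (ρ t m).2
        simp only [h.not_gt, iff_false]
        omega
    rw [if_congr (and_congr hlt Iff.rfl) rfl rfl]
    split_ifs with h
    · obtain ⟨s, k, rfl⟩ := ω.exists_emb i
      obtain ⟨t, m, rfl⟩ := ω.exists_emb j
      rw [Word.apply_emb, Word.apply_emb] at h
      rw [val_nodeGlue_emb, val_nodeGlue_emb, Word.apply_emb, Word.apply_emb, oddsRatio,
        pSwap_cross _ _ _ _ _ _ h.1 (Fin.is_lt _) (Fin.is_lt _)]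
      have h1 := hS s
      have h2 := hS t
      field_simp
      ring
    · rfl
  · refine Finset.prod_congr rfl fun s _ => ?_
    rw [treeW_eq_prod]
    refine Finset.prod_congr rfl fun k _ => Finset.prod_congr rfl fun k' _ => ?_
    have hlt : nodeGlue ω ρ (ω.emb s k) < nodeGlue ω ρ (ω.emb s k') ↔ ρ s k < ρ s k' := by
      rw [← Fin.val_fin_lt, val_nodeGlue_emb, val_nodeGlue_emb, ← Fin.val_fin_lt]
      omega
    rw [if_congr (and_congr hlt (ω.emb s).lt_iff_lt) rfl rfl, val_nodeGlue_emb, val_nodeGlue_emb,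
      oddsRatio, oddsRatio, pSwap_same _ _ _ _ _ _ _ (Fin.is_lt _) (Fin.is_lt _)]

end Generator

theorem ratioBound_mono {q Q : ℝ} (h : q ≤ Q) : ∀ {T : STree}, T.RatioBound q → T.RatioBound Q
  | .leaf, _ => trivial
  | .node _ _ _ _ _ _, ⟨h1, h2, h3, h4, h5⟩ =>
    ⟨h1.trans h, h2.trans h, ratioBound_mono h h3, ratioBound_mono h h4, ratioBound_mono h h5⟩

theorem kidStrength_pos {sL sC sR : ℝ} (hL : 0 < sL) (hLC : sL < sC) (hCR : sC < sR) (s : Fin 3) :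
    0 < kidStrength sL sC sR s := by
  fin_cases s <;> simp [kidStrength] <;> linarith

theorem isSystem_tree {Q a c : ℝ} (hQ : Q < 1 / 2) (ha : 1 < a) (ha2 : a ≤ 2)
    (hQa : 2 * Q * a < 1) (hc : c = (a - 1) * (1 / a - 2 * Q) / 2) {J : ℕ}
    (hJ : 2 * (2 * c + 2) / c ≤ a ^ J) : ∀ T : STree, T.Valid → T.RatioBound Q →
    IsSystem (2 / c * (1 + (2 * c + 2) * localConst (2 * J))) a c
      ((T.numLeaves : ℝ) * (T.numLeaves - 1) / 2) (T.numLeaves - 1) (T.numLeaves ^ 2)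
      (treeW T) (treeGen T)
  | .leaf, _, _ => by
    have : Unique (Fin STree.leaf.numLeaves) := inferInstanceAs (Unique (Fin 1))
    have h := isSystem_of_unique (Ω₁ := Equiv.Perm (Fin STree.leaf.numLeaves))
      (K := 2 / c * (1 + (2 * c + 2) * localConst (2 * J))) (a := a) (c := c)
      (d := ((STree.leaf.numLeaves : ℝ) * (STree.leaf.numLeaves - 1) / 2))
      (m := STree.leaf.numLeaves - 1) (M := STree.leaf.numLeaves ^ 2)
      (by simp [STree.numLeaves])
    refine h.congr (Equiv.refl _) (fun σ => ?_) fun F σ => ?_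
    · simp [treeW, Subsingleton.elim _ (default : Fin STree.leaf.numLeaves)]
    · simp [treeGen, Subsingleton.elim _ (default : Fin STree.leaf.numLeaves)]
  | .node sL sC sR l c' r, ⟨v1, v2, v3, _, _, vl, vc, vr⟩, ⟨b1, b2, bl, bc, br⟩ => by
    have hl := isSystem_tree hQ ha ha2 hQa hc hJ l vl bl
    have hcc := isSystem_tree hQ ha ha2 hQa hc hJ c' vc bc
    have hr := isSystem_tree hQ ha ha2 hQa hc hJ r vr br
    have pl := numLeaves_pos l
    have pc := numLeaves_pos c'
    have pr := numLeaves_pos r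
    have hn : (STree.node sL sC sR l c' r).numLeaves =
      l.numLeaves + c'.numLeaves + r.numLeaves := rfl
    have hS := kidStrength_pos v1 v2 v3
    have hk : ∀ s, IsSystem (2 / c * (1 + (2 * c + 2) * localConst (2 * J))) a c
        (((kids l c' r s).numLeaves : ℝ) * ((kids l c' r s).numLeaves - 1) / 2)
        ((kids l c' r s).numLeaves - 1) ((STree.node sL sC sR l c' r).numLeaves ^ 2)
        (treeW (kids l c' r s)) (treeGen (kids l c' r s)) := by
      intro s
      fin_cases s
      · exact hl.mono le_rfl le_rfl (Nat.pow_le_pow_left (by omega) 2)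
      · exact hcc.mono le_rfl le_rfl (Nat.pow_le_pow_left (by omega) 2)
      · exact hr.mono le_rfl le_rfl (Nat.pow_le_pow_left (by omega) 2)
    have hw := isSystem_word (n := (STree.node sL sC sR l c' r).numLeaves)
      (num := fun s => (kids l c' r s).numLeaves) hS b1 b2 hQ ha ha2 hQa hc hJ
    have hp := (hw.prod (IsSystem.pi hk)).congr (Word.glueEquiv (leafEquiv sL sC sR l c' r))
      (fun x => treeW_nodeGlue x.1 x.2 hS) (fun F x => treeGen_nodeGlue x.1 x.2 hS F)
    refine hp.mono ?_ ?_ le_rfl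
    · rw [Fin.sum_univ_three, hn]
      simp only [kids, Matrix.cons_val]
      have ql : (1 : ℝ) ≤ l.numLeaves := by exact_mod_cast pl
      have qc : (1 : ℝ) ≤ c'.numLeaves := by exact_mod_cast pc
      have qr : (1 : ℝ) ≤ r.numLeaves := by exact_mod_cast pr
      push_cast
      nlinarith [mul_nonneg (sub_nonneg.2 ql) (sub_nonneg.2 qc),
        mul_nonneg (sub_nonneg.2 ql) (sub_nonneg.2 qr),
        mul_nonneg (sub_nonneg.2 qc) (sub_nonneg.2 qr)]
    · rw [Fin.sum_univ_three, hn]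
      simp only [kids, Matrix.cons_val]
      omega

section Mixing

open Matrix

variable {Ω : Type*} [Fintype Ω] {P : Matrix Ω Ω ℝ} {K a c N : ℝ} {m M : ℕ}
  {W : Ω → ℝ} {G : (Ω → ℝ) → Ω → ℝ}

theorem mulVec_const (h : IsSystem K a c N m M W G)
    (hP : ∀ F x, (P *ᵥ F) x = F x + G F x / N) (b : ℝ) : P *ᵥ (fun _ => b) = fun _ => b := by
  funext x
  rw [hP, h.gen_const]
  simp

theorem sum_weight_mulVec (h : IsSystem K a c N m M W G)
    (hP : ∀ F x, (P *ᵥ F) x = F x + G F x / N) (F : Ω → ℝ) :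
    ∑ x, W x * (P *ᵥ F) x = ∑ x, W x * F x := by
  have h1 := h.symm (fun _ => 1) F
  simp only [h.gen_const, mul_zero, Finset.sum_const_zero, mul_one] at h1
  have h2 : ∑ x, W x * (P *ᵥ F) x = ∑ x, W x * F x + (∑ x, W x * G F x) / N := by
    rw [Finset.sum_div, ← Finset.sum_add_distrib]
    exact Finset.sum_congr rfl fun x _ => by rw [hP]; ring
  rw [h2, h1]
  simp

theorem sum_mul_mulVec (hP : ∀ F x, (P *ᵥ F) x = F x + G F x / N) (F H : Ω → ℝ) :
    ∑ x, W x * F x * (P *ᵥ H) x = ∑ x, W x * F x * H x + (∑ x, W x * F x * G H x) / N := by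
  rw [Finset.sum_div, ← Finset.sum_add_distrib]
  exact Finset.sum_congr rfl fun x _ => by rw [hP]; ring

theorem sum_sq_mulVec_le (h : IsSystem K a c N m M W G)
    (hP : ∀ F x, (P *ᵥ F) x = F x + G F x / N) (hN : 0 < N) (hK : 0 < K) {F : Ω → ℝ}
    (hF : ∑ x, W x * F x = 0) :
    ∑ x, W x * (P *ᵥ F) x ^ 2 ≤ Real.exp (-(1 / (K * N))) * ∑ x, W x * F x ^ 2 := by
  rcases isEmpty_or_nonempty Ω with hΩ | hΩ
  · simp
  have hW := h.weight_pos
  have hZ : 0 < ∑ x, W x := Finset.sum_pos (fun x _ => hW x) Finset.univ_nonempty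
  have hsymm : ∀ A B : Ω → ℝ, ∑ x, W x * A x * (P *ᵥ B) x = ∑ x, W x * B x * (P *ᵥ A) x := by
    intro A B
    rw [sum_mul_mulVec hP, sum_mul_mulVec hP, h.symm A B]
    congr 1
    exact Finset.sum_congr rfl fun x _ => by ring
  have hpos : ∀ H : Ω → ℝ, 0 ≤ ∑ x, W x * H x * (P *ᵥ H) x := by
    intro H
    rw [sum_mul_mulVec hP]
    have h1 := h.dirichlet_le H
    simp only [mul_neg, Finset.sum_neg_distrib] at h1
    have h2 : ∑ x, W x * H x * H x = ∑ x, W x * H x ^ 2 :=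
      Finset.sum_congr rfl fun x _ => by ring
    rw [h2, ← sub_neg_eq_add, ← neg_div, sub_nonneg, div_le_iff₀ hN]
    linarith
  have hdir : ∀ H : Ω → ℝ, 0 ≤ ∑ x, W x * H x * (-G H x) := by
    intro H
    have h1 := h.poincare H
    have h2 : 0 ≤ (∑ x, W x) * (∑ x, W x * H x ^ 2) - (∑ x, W x * H x) ^ 2 := by
      rw [sub_nonneg]
      refine (Finset.sum_sq_le_sum_mul_sum_of_sq_le_mul Finset.univ (fun x _ => (hW x).le)
        (fun x _ => mul_nonneg (hW x).le (sq_nonneg _)) fun x _ => le_of_eq ?_)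
      ring
    have h3 := h2.trans h1
    exact nonneg_of_mul_nonneg_right h3 (mul_pos hK hZ)
  have hcontr : ∀ H : Ω → ℝ, ∑ x, W x * H x * (P *ᵥ H) x ≤ ∑ x, W x * H x ^ 2 := by
    intro H
    rw [sum_mul_mulVec hP]
    have h1 := hdir H
    simp only [mul_neg, Finset.sum_neg_distrib] at h1
    have h2 : ∑ x, W x * H x * H x = ∑ x, W x * H x ^ 2 :=
      Finset.sum_congr rfl fun x _ => by ring
    have h3 : (∑ x, W x * H x * G H x) / N ≤ 0 := div_nonpos_of_nonpos_of_nonneg (by linarith) hN.le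
    linarith
  have key : ∑ x, W x * (P *ᵥ F) x ^ 2 ≤ ∑ x, W x * F x * (P *ᵥ F) x := by
    have h1 := hpos (F - P *ᵥ F)
    have h2 := hcontr (P *ᵥ F)
    have h3 := hsymm F (P *ᵥ F)
    rw [Matrix.mulVec_sub] at h1
    have h4 : ∑ x, W x * (F - P *ᵥ F) x * (P *ᵥ F - P *ᵥ (P *ᵥ F)) x =
        ∑ x, W x * F x * (P *ᵥ F) x - ∑ x, W x * F x * (P *ᵥ (P *ᵥ F)) x -
          ∑ x, W x * (P *ᵥ F) x * (P *ᵥ F) x + ∑ x, W x * (P *ᵥ F) x * (P *ᵥ (P *ᵥ F)) x := by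
      rw [← Finset.sum_sub_distrib, ← Finset.sum_sub_distrib, ← Finset.sum_add_distrib]
      exact Finset.sum_congr rfl fun x _ => by simp only [Pi.sub_apply]; ring
    have h5 : ∑ x, W x * (P *ᵥ F) x * (P *ᵥ F) x = ∑ x, W x * (P *ᵥ F) x ^ 2 :=
      Finset.sum_congr rfl fun x _ => by ring
    linarith
  refine key.trans ?_
  have h1 := h.poincare F
  rw [hF] at h1
  have h2 : ∑ x, W x * F x ^ 2 ≤ K * ∑ x, W x * F x * (-G F x) := by
    refine le_of_mul_le_mul_left ?_ hZ
    linarith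
  simp only [mul_neg, Finset.sum_neg_distrib] at h2
  rw [sum_mul_mulVec hP]
  have h3 : ∑ x, W x * F x * F x = ∑ x, W x * F x ^ 2 :=
    Finset.sum_congr rfl fun x _ => by ring
  rw [h3]
  have h4 : 0 ≤ ∑ x, W x * F x ^ 2 :=
    Finset.sum_nonneg fun x _ => mul_nonneg (hW x).le (sq_nonneg _)
  have h5 : 1 - 1 / (K * N) ≤ Real.exp (-(1 / (K * N))) := by
    linarith [Real.add_one_le_exp (-(1 / (K * N)))]
  have h6 : (∑ x, W x * F x * G F x) / N ≤ -(1 / (K * N)) * ∑ x, W x * F x ^ 2 := by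
    rw [div_le_iff₀ hN]
    have h7 : -(1 / (K * N)) * (∑ x, W x * F x ^ 2) * N = -((∑ x, W x * F x ^ 2) / K) := by
      field_simp
    rw [h7, le_neg, div_le_iff₀ hK]
    linarith
  nlinarith

variable [DecidableEq Ω]

theorem pow_nonneg_entries (hP0 : ∀ x y, 0 ≤ P x y) (t : ℕ) (x y : Ω) : 0 ≤ (P ^ t) x y := by
  induction t generalizing x y with
  | zero =>
    rw [pow_zero, Matrix.one_apply]
    split_ifs <;> simp
  | succ t ih =>
    rw [pow_succ, Matrix.mul_apply]
    exact Finset.sum_nonneg fun z _ => mul_nonneg (ih x z) (hP0 z y)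

theorem pow_mulVec_mono (hP0 : ∀ x y, 0 ≤ P x y) (t : ℕ) {F H : Ω → ℝ} (h : ∀ x, F x ≤ H x)
    (x : Ω) : (P ^ t *ᵥ F) x ≤ (P ^ t *ᵥ H) x :=
  Finset.sum_le_sum fun y _ => mul_le_mul_of_nonneg_left (h y) (pow_nonneg_entries hP0 t x y)

theorem pow_succ_mulVec (t : ℕ) (F : Ω → ℝ) : P ^ (t + 1) *ᵥ F = P ^ t *ᵥ (P *ᵥ F) := by
  rw [pow_succ, Matrix.mulVec_mulVec]

theorem pow_succ_mulVec' (t : ℕ) (F : Ω → ℝ) : P ^ (t + 1) *ᵥ F = P *ᵥ (P ^ t *ᵥ F) := by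
  rw [pow_succ', Matrix.mulVec_mulVec]

theorem pow_mulVec_const (hP1 : ∀ b : ℝ, P *ᵥ (fun _ => b) = fun _ => b) (t : ℕ) (b : ℝ) :
    P ^ t *ᵥ (fun _ => b) = fun _ => b := by
  induction t with
  | zero => simp
  | succ t ih => rw [pow_succ_mulVec, hP1, ih]

theorem abs_pow_mulVec_le (hP0 : ∀ x y, 0 ≤ P x y) (t : ℕ) {F H : Ω → ℝ}
    (h : ∀ x, |F x| ≤ H x) (x : Ω) : |(P ^ t *ᵥ F) x| ≤ (P ^ t *ᵥ H) x := by
  have h1 := pow_mulVec_mono hP0 t (fun y => (abs_le.1 (h y)).2) x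
  have h2 := pow_mulVec_mono hP0 t (F := -H) (H := F) (fun y => (abs_le.1 (h y)).1) x
  rw [Matrix.mulVec_neg] at h2
  exact abs_le.2 ⟨h2, h1⟩

theorem sum_sq_pow_mulVec_le (h : IsSystem K a c N m M W G)
    (hP : ∀ F x, (P *ᵥ F) x = F x + G F x / N) (hN : 0 < N) (hK : 0 < K) {F : Ω → ℝ}
    (hF : ∑ x, W x * F x = 0) (t : ℕ) :
    ∑ x, W x * (P ^ t *ᵥ F) x ^ 2 ≤ Real.exp (-(t / (K * N))) * ∑ x, W x * F x ^ 2 := by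
  have h0 : ∀ t : ℕ, ∑ x, W x * (P ^ t *ᵥ F) x = 0 := by
    intro t
    induction t with
    | zero => simpa using hF
    | succ t ih => rw [pow_succ_mulVec', sum_weight_mulVec h hP, ih]
  induction t with
  | zero => simp
  | succ t ih =>
    rw [pow_succ_mulVec']
    refine (sum_sq_mulVec_le h hP hN hK (h0 t)).trans ?_
    refine (mul_le_mul_of_nonneg_left ih (Real.exp_pos _).le).trans_eq ?_
    rw [← mul_assoc, ← Real.exp_add]
    congr 2
    push_cast
    ring

theorem pow_mulVec_drift_le (hP0 : ∀ x y, 0 ≤ P x y)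
    (hP1 : ∀ b : ℝ, P *ᵥ (fun _ => b) = fun _ => b)
    (hP : ∀ F x, (P *ᵥ F) x = F x + G F x / N) (hN : 1 ≤ N) (hc : 0 < c) (hc1 : c ≤ 1) {r : ℝ}
    (hr : 0 ≤ r) {I : Ω → ℕ} (hI : ∀ x, G (fun y => a ^ I y) x ≤ -c * (a ^ I x - 1) + r) (s : ℕ)
    (x : Ω) : (P ^ s *ᵥ fun y => a ^ I y - 1) x ≤ (1 - c / N) ^ s * (a ^ I x - 1) + r / c := by
  have hN0 : 0 < N := by linarith
  have hrc : 0 ≤ r / c := div_nonneg hr hc.le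
  have hlam : 0 ≤ 1 - c / N := by
    rw [sub_nonneg, div_le_one hN0]
    linarith
  set φ : Ω → ℝ := fun y => a ^ I y - 1 with hφ
  have hstep : ∀ y, (P *ᵥ φ) y ≤ ((1 - c / N) • φ + (fun _ => r / N : Ω → ℝ)) y := by
    intro y
    have h1 : φ = (fun y => a ^ I y) - fun _ => (1 : ℝ) := rfl
    rw [h1, Matrix.mulVec_sub, hP1, Pi.sub_apply, hP]
    have h2 := div_le_div_of_nonneg_right (hI y) hN0.le
    have h3 : (-c * (a ^ I y - 1) + r) / N = -(c / N) * (a ^ I y - 1) + r / N := by ring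
    simp only [Pi.add_apply, Pi.smul_apply, Pi.sub_apply, smul_eq_mul]
    linarith
  induction s with
  | zero => simpa [hφ] using hrc
  | succ s ih =>
    rw [pow_succ_mulVec]
    refine (pow_mulVec_mono hP0 s hstep x).trans ?_
    rw [Matrix.mulVec_add, Matrix.mulVec_smul, pow_mulVec_const hP1]
    simp only [Pi.add_apply, Pi.smul_apply, smul_eq_mul]
    have h1 := mul_le_mul_of_nonneg_left ih hlam
    have h2 : (1 - c / N) * (r / c) + r / N = r / c := by
      field_simp
      ring
    have h3 : (1 - c / N) * ((1 - c / N) ^ s * φ x + r / c) + r / N =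
        (1 - c / N) ^ (s + 1) * φ x + ((1 - c / N) * (r / c) + r / N) := by ring
    change _ ≤ (1 - c / N) ^ (s + 1) * φ x + r / c
    rw [← h2, ← h3]
    linarith

end Mixing

section Mixing

open Matrix

variable {Ω : Type*} [Fintype Ω] {P : Matrix Ω Ω ℝ} {K a c N ρ : ℝ} {m M : ℕ}
  {W : Ω → ℝ} {G : (Ω → ℝ) → Ω → ℝ}

theorem pow_le_prod_of_small {Ω : Type*} (hρ : 0 < ρ) (hρ1 : ρ ≤ 1) {x : Ω}
    (l : List (ℝ × (Ω → ℕ))) (h : ∀ o ∈ l, 0 < o.1 ∧ o.2 x ≤ M ∧ (o.1 < ρ → o.2 x = 0)) :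
    ρ ^ (l.length * M) ≤ (l.map fun o => o.1 ^ o.2 x).prod := by
  induction l with
  | nil => simp
  | cons o l ih =>
    rw [List.map_cons, List.prod_cons, List.length_cons, Nat.succ_mul, pow_add, mul_comm]
    obtain ⟨h1, h2, h3⟩ := h o List.mem_cons_self
    refine mul_le_mul ?_ (ih fun o' ho' => h o' (List.mem_cons_of_mem _ ho')) (by positivity)
      (by positivity)
    rcases lt_or_ge o.1 ρ with h4 | h4
    · rw [h3 h4, pow_zero]
      exact pow_le_one₀ hρ.le hρ1
    · exact (pow_le_pow_of_le_one hρ.le hρ1 h2).trans (pow_le_pow_left₀ hρ.le h4 _)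

variable [DecidableEq Ω]

theorem pow_mulVec_drift_sum_le (hP0 : ∀ x y, 0 ≤ P x y)
    (hP1 : ∀ b : ℝ, P *ᵥ (fun _ => b) = fun _ => b)
    (hP : ∀ F x, (P *ᵥ F) x = F x + G F x / N) (hN : 1 ≤ N) (ha : 1 < a) (hc : 0 < c)
    (hc1 : c ≤ 1) (l : List (ℝ × (Ω → ℕ)))
    (hl : ∀ o ∈ l, 0 ≤ o.1 ∧ o.1 ≤ ρ ∧ (∀ x, o.2 x ≤ M) ∧
      ∀ x, G (fun y => a ^ o.2 y) x ≤ -c * (a ^ o.2 x - 1) + o.1) (s : ℕ) (x : Ω) :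
    (P ^ s *ᵥ fun y => (l.map fun o => a ^ o.2 y - 1).sum) x ≤
      l.length * ((1 - c / N) ^ s * a ^ M + ρ / c) := by
  induction l with
  | nil =>
    have := congrFun (pow_mulVec_const hP1 s 0) x
    simpa using this.le
  | cons o l ih =>
    obtain ⟨h1, h2, h3, h4⟩ := hl o List.mem_cons_self
    have h5 := pow_mulVec_drift_le hP0 hP1 hP hN hc hc1 h1 h4 s x
    have h6 := ih fun o' ho' => hl o' (List.mem_cons_of_mem _ ho')
    have h7 : (fun y => ((o :: l).map fun o => a ^ o.2 y - 1).sum) =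
        (fun y => a ^ o.2 y - 1) + fun y => (l.map fun o => a ^ o.2 y - 1).sum := by
      funext y
      simp
    rw [h7, Matrix.mulVec_add, Pi.add_apply, List.length_cons]
    push_cast
    have hlam : 0 ≤ 1 - c / N := by
      rw [sub_nonneg, div_le_one (by linarith)]
      linarith
    have h8 : a ^ o.2 x - 1 ≤ a ^ M := by
      linarith [pow_le_pow_right₀ ha.le (h3 x)]
    have h9 := mul_le_mul_of_nonneg_left h8 (pow_nonneg hlam s)
    have h10 := div_le_div_of_nonneg_right h2 hc.le
    linarith

theorem abs_pow_mulVec_le_half (h : IsSystem K a c N m M W G) (hP0 : ∀ x y, 0 ≤ P x y)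
    (hP : ∀ F x, (P *ᵥ F) x = F x + G F x / N) (hN : 1 ≤ N) (hK : 0 < K) (ha : 1 < a)
    (hc : 0 < c) (hc1 : c ≤ 1) (hρ : 0 < ρ) (hρ1 : ρ ≤ 1) {s t : ℕ}
    (hs : m * ((1 - c / N) ^ s * a ^ M + ρ / c) ≤ (a - 1) / 8)
    (ht : 64 * ∑ x, W x ≤ ρ ^ (m * M) * Real.exp (t / (K * N))) {F : Ω → ℝ}
    (hF : ∀ x, |F x| ≤ 2) (hF0 : ∑ x, W x * F x = 0) (x : Ω) :
    |(P ^ (s + t) *ᵥ F) x| ≤ 1 / 2 := by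
  have hP1 := mulVec_const h hP
  have hN0 : 0 < N := by linarith
  have hlam : 0 ≤ 1 - c / N := by
    rw [sub_nonneg, div_le_one (by linarith)]
    linarith
  obtain ⟨l, hlm, hW, hl⟩ := h.drift
  set u : Ω → ℝ := P ^ t *ᵥ F with hu
  have hu2 : ∀ z, |u z| ≤ 2 := fun z =>
    (abs_pow_mulVec_le hP0 t hF z).trans (by rw [pow_mulVec_const hP1])
  have huW : ∀ z, W z * u z ^ 2 ≤ Real.exp (-(t / (K * N))) * (4 * ∑ x, W x) := by
    intro z
    have h1 := sum_sq_pow_mulVec_le h hP hN0 hK hF0 t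
    have h2 : ∑ x, W x * F x ^ 2 ≤ 4 * ∑ x, W x := by
      rw [Finset.mul_sum]
      refine Finset.sum_le_sum fun y _ => ?_
      have h3 : F y ^ 2 ≤ 2 ^ 2 := sq_le_sq' (by linarith [(abs_le.1 (hF y)).1])
        (abs_le.1 (hF y)).2
      nlinarith [h.weight_pos y]
    refine (Finset.single_le_sum (f := fun z => W z * u z ^ 2)
      (fun y _ => mul_nonneg (h.weight_pos y).le (sq_nonneg _)) (Finset.mem_univ z)).trans
      (h1.trans ?_)
    exact mul_le_mul_of_nonneg_left h2 (Real.exp_pos _).le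
  classical
  set l' := l.filter fun o => o.1 < ρ with hl'
  set Ψ : Ω → ℝ := fun z => (l'.map fun o => a ^ o.2 z - 1).sum with hΨ
  have hterm : ∀ z, ∀ y ∈ l'.map (fun o => a ^ o.2 z - 1), 0 ≤ y := by
    intro z y hy
    obtain ⟨o, -, rfl⟩ := List.mem_map.1 hy
    exact sub_nonneg.2 (one_le_pow₀ ha.le)
  have hpt : ∀ z, |u z| ≤ 1 / 4 + 2 / (a - 1) * Ψ z := by
    intro z
    have hΨ0 : 0 ≤ Ψ z := List.sum_nonneg (hterm z)
    have ha1 : 0 < a - 1 := by linarith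
    by_cases hz : ∀ o ∈ l, o.1 < ρ → o.2 z = 0
    · have h1 : ρ ^ (m * M) ≤ W z := by
        rw [hW z]
        refine le_trans ?_ (pow_le_prod_of_small hρ hρ1 l
          fun o ho => ⟨(hl o ho).1, (hl o ho).2.2.1 z, hz o ho⟩)
        exact pow_le_pow_of_le_one hρ.le hρ1 (Nat.mul_le_mul_right M hlm)
      have h2 := huW z
      have hE := Real.exp_pos (t / (K * N))
      rw [Real.exp_neg, inv_mul_eq_div, le_div_iff₀ hE] at h2
      have h3 : ρ ^ (m * M) * Real.exp (t / (K * N)) * (16 * u z ^ 2) ≤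
          ρ ^ (m * M) * Real.exp (t / (K * N)) * 1 := by
        have h4 := mul_le_mul_of_nonneg_right h1 (mul_nonneg (sq_nonneg (u z)) hE.le)
        linarith
      have h4 := le_of_mul_le_mul_left h3 (by positivity)
      have h5 : |u z| ≤ 1 / 4 := by
        refine abs_le_of_sq_le_sq ?_ (by norm_num)
        linarith
      have h6 : 0 ≤ 2 / (a - 1) * Ψ z := by positivity
      linarith
    · push Not at hz
      obtain ⟨o, ho, hoρ, hoz⟩ := hz
      have h1 : a ^ o.2 z - 1 ≤ Ψ z := by
        refine List.single_le_sum (hterm z) _ (List.mem_map.2 ⟨o, ?_, rfl⟩)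
        exact List.mem_filter.2 ⟨ho, by simpa using hoρ⟩
      have h2 : a ≤ a ^ o.2 z := le_self_pow₀ ha.le hoz
      have h3 : 2 ≤ 2 / (a - 1) * Ψ z := by
        rw [div_mul_eq_mul_div, le_div_iff₀ ha1]
        linarith
      linarith [hu2 z]
  have h1 : |(P ^ (s + t) *ᵥ F) x| ≤
      (P ^ s *ᵥ ((fun _ => 1 / 4) + (2 / (a - 1)) • Ψ)) x := by
    rw [pow_add, ← Matrix.mulVec_mulVec]
    exact abs_pow_mulVec_le hP0 s hpt x
  rw [Matrix.mulVec_add, Matrix.mulVec_smul, pow_mulVec_const hP1] at h1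
  simp only [Pi.add_apply, Pi.smul_apply, smul_eq_mul] at h1
  have h2 : (P ^ s *ᵥ Ψ) x ≤ (a - 1) / 8 := by
    refine (pow_mulVec_drift_sum_le (ρ := ρ) (M := M) hP0 hP1 hP hN ha hc hc1 l' ?_ s x).trans
      (le_trans ?_ hs)
    · intro o ho
      obtain ⟨h3, h4⟩ := List.mem_filter.1 ho
      obtain ⟨h5, -, h6, h7⟩ := hl o h3
      exact ⟨h5.le, (of_decide_eq_true h4).le, h6, h7⟩
    · refine mul_le_mul_of_nonneg_right ?_ (by positivity)
      exact_mod_cast (List.length_filter_le _ l).trans hlm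
  have ha1 : 0 < a - 1 := by linarith
  have h3 : 2 / (a - 1) * (P ^ s *ᵥ Ψ) x ≤ 2 / (a - 1) * ((a - 1) / 8) :=
    mul_le_mul_of_nonneg_left h2 (by positivity)
  have h4 : 2 / (a - 1) * ((a - 1) / 8) = 1 / 4 := by
    field_simp
    norm_num
  linarith

theorem half_sum_abs_pow_sub_le (h : IsSystem K a c N m M W G) (hP0 : ∀ x y, 0 ≤ P x y)
    (hP : ∀ F x, (P *ᵥ F) x = F x + G F x / N) (hN : 1 ≤ N) (hK : 0 < K) (ha : 1 < a)
    (hc : 0 < c) (hc1 : c ≤ 1) (hρ : 0 < ρ) (hρ1 : ρ ≤ 1) {s t₀ : ℕ}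
    (hs : m * ((1 - c / N) ^ s * a ^ M + ρ / c) ≤ (a - 1) / 8)
    (ht₀ : 64 * ∑ x, W x ≤ ρ ^ (m * M) * Real.exp (t₀ / (K * N))) {t : ℕ} (ht : s + t₀ ≤ t)
    (x : Ω) : 1 / 2 * ∑ y, |(P ^ t) x y - W y / ∑ z, W z| ≤ 1 / 4 := by
  have hZ : 0 < ∑ z, W z := Finset.sum_pos (fun z _ => h.weight_pos z) ⟨x, Finset.mem_univ x⟩
  set Z := ∑ z, W z with hZdef
  have hP1 := mulVec_const h hP
  obtain ⟨k, rfl⟩ := Nat.exists_eq_add_of_le ht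
  set f : Ω → ℝ := fun y => (SignType.sign ((P ^ (s + t₀ + k)) x y - W y / Z) : ℝ) with hf
  have hf1 : ∀ y, |f y| ≤ 1 := by
    intro y
    simp only [hf]
    cases SignType.sign ((P ^ (s + t₀ + k)) x y - W y / Z) <;> simp
  set b : ℝ := (∑ y, W y * f y) / Z with hb
  have hb1 : |b| ≤ 1 := by
    rw [hb, abs_div, abs_of_pos hZ, div_le_one hZ, hZdef]
    refine (Finset.abs_sum_le_sum_abs _ _).trans (Finset.sum_le_sum fun y _ => ?_)
    rw [abs_mul, abs_of_pos (h.weight_pos y)]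
    exact mul_le_of_le_one_right (h.weight_pos y).le (hf1 y)
  have hF : ∀ y, |(f - (fun _ => b : Ω → ℝ)) y| ≤ 2 := fun y =>
    (abs_sub _ _).trans (by linarith [hf1 y])
  have hF0 : ∑ y, W y * (f - (fun _ => b : Ω → ℝ)) y = 0 := by
    simp only [Pi.sub_apply, mul_sub, Finset.sum_sub_distrib, ← Finset.sum_mul]
    rw [hb, mul_div_cancel₀ _ hZ.ne', sub_self]
  have hk : 64 * ∑ x, W x ≤ ρ ^ (m * M) * Real.exp ((t₀ + k : ℕ) / (K * N)) := by
    refine ht₀.trans (mul_le_mul_of_nonneg_left (Real.exp_le_exp.2 ?_) (by positivity))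
    refine div_le_div_of_nonneg_right ?_ (by nlinarith)
    push_cast
    linarith [(Nat.cast_nonneg k : (0 : ℝ) ≤ k)]
  have h1 := abs_pow_mulVec_le_half h hP0 hP hN hK ha hc hc1 hρ hρ1 hs hk hF hF0 x
  rw [← add_assoc, Matrix.mulVec_sub, pow_mulVec_const hP1, Pi.sub_apply] at h1
  have h2 : ∑ y, |(P ^ (s + t₀ + k)) x y - W y / Z| = (P ^ (s + t₀ + k) *ᵥ f) x - b := by
    have h3 : (P ^ (s + t₀ + k) *ᵥ f) x - b =
        ∑ y, ((P ^ (s + t₀ + k)) x y - W y / Z) * f y := by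
      simp only [Matrix.mulVec, dotProduct, hb, Finset.sum_div, ← Finset.sum_sub_distrib]
      exact Finset.sum_congr rfl fun y _ => by ring
    rw [h3]
    exact Finset.sum_congr rfl fun y _ => (self_mul_sign _).symm
  rw [h2]
  linarith [(abs_le.1 h1).2]

end Mixing

theorem pSwap_mem_Icc : ∀ {T : STree}, T.Valid → ∀ i j, 0 ≤ T.pSwap i j ∧ T.pSwap i j ≤ 1
  | .leaf, _, _, _ => by simp [STree.pSwap]
  | .node sL sC sR l c r, ⟨v1, v2, v3, _, _, vl, vc, vr⟩, i, j => by
    have key : ∀ {x y : ℝ}, 0 < x → 0 < y → 0 ≤ x / (x + y) ∧ x / (x + y) ≤ 1 := by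
      intro x y hx hy
      refine ⟨by positivity, ?_⟩
      rw [div_le_one (by positivity)]
      linarith
    have v4 : 0 < sC := v1.trans v2
    have v5 : 0 < sR := v4.trans v3
    simp only [STree.pSwap]
    split_ifs
    · exact pSwap_mem_Icc vl _ _
    · exact key v4 v1
    · exact key v5 v1
    · exact pSwap_mem_Icc vc _ _
    · exact key v5 v4
    · exact pSwap_mem_Icc vr _ _

theorem treeP_nonneg {T : STree} (hT : T.Valid) (σ τ : Equiv.Perm (Fin T.numLeaves)) :
    0 ≤ treeP T σ τ := by
  refine mul_nonneg (by positivity) (Finset.sum_nonneg fun i _ => Finset.sum_nonneg fun j _ => ?_)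
  have h := pSwap_mem_Icc hT (min (σ i : ℕ) (σ j : ℕ)) (max (σ i : ℕ) (σ j : ℕ))
  have h1 := h.1
  have h2 := sub_nonneg.2 h.2
  split_ifs <;> simp [h1, h2]

theorem sum_sum_ite_lt (n : ℕ) (b : ℝ) :
    ∑ i : Fin n, ∑ j : Fin n, (if i < j then b else 0) = (n.choose 2 : ℝ) * b := by
  rw [Finset.sum_comm]
  have h : ∀ j : Fin n, ∑ i : Fin n, (if i < j then b else 0) = ((j : ℕ) : ℝ) * b := by
    intro j
    rw [← Finset.sum_filter, Finset.sum_const, nsmul_eq_mul]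
    congr 2
    rw [← Fin.card_Iio j]
    congr 1
    ext i
    simp
  simp only [h, ← Finset.sum_mul]
  congr 1
  rw [Fin.sum_univ_eq_sum_range (fun j => (j : ℝ)) n, ← Nat.cast_sum, Finset.sum_range_id,
    Nat.choose_two_right]

theorem treeP_mulVec {T : STree} (hn : 2 ≤ T.numLeaves)
    (F : Equiv.Perm (Fin T.numLeaves) → ℝ) (σ : Equiv.Perm (Fin T.numLeaves)) :
    (Matrix.mulVec (treeP T) F) σ = F σ + treeGen T F σ / (T.numLeaves.choose 2 : ℝ) := by
  have hN : (T.numLeaves.choose 2 : ℝ) ≠ 0 := by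
    exact_mod_cast (Nat.choose_pos hn).ne'
  have hδ : ∀ (q q' : ℝ) (α β : Equiv.Perm (Fin T.numLeaves)),
      ∑ τ, (q * (if τ = α then 1 else 0) + q' * (if τ = β then 1 else 0)) * F τ =
        q * F α + q' * F β := by
    intro q q' α β
    simp [add_mul, Finset.sum_add_distrib]
  have hterm : (T.numLeaves.choose 2 : ℝ) * Matrix.mulVec (treeP T) F σ =
      (T.numLeaves.choose 2 : ℝ) * F σ + treeGen T F σ := by
    rw [← sum_sum_ite_lt _ (F σ), treeGen, ← Finset.sum_add_distrib]
    simp only [← Finset.sum_add_distrib, Matrix.mulVec, dotProduct, treeP, Finset.mul_sum,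
      Finset.sum_mul]
    rw [Finset.sum_comm]
    refine Finset.sum_congr rfl fun i _ => ?_
    rw [Finset.sum_comm]
    refine Finset.sum_congr rfl fun j _ => ?_
    have h1 : ∀ b x : ℝ, (T.numLeaves.choose 2 : ℝ) * (1 / (T.numLeaves.choose 2 : ℝ) * b * x) =
        b * x := by
      intro b x
      field_simp
    simp only [h1]
    by_cases hij : i < j
    · by_cases hf : Free T σ i j
      · simp only [if_pos hij, if_pos (show i < j ∧ Free T σ i j from ⟨hij, hf⟩)]
        rw [Free] at hf
        simp only [if_pos hf, hδ, swapProb]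
        split_ifs <;> ring
      · simp only [if_pos hij, if_neg (show ¬(i < j ∧ Free T σ i j) from fun h => hf h.2)]
        rw [Free] at hf
        simp only [if_neg hf]
        simp
    · simp [hij]
  field_simp
  linarith

theorem exists_burn_in_time {a c N : ℝ} {n m : ℕ} (ha : 1 < a) (ha2 : a ≤ 2) (hc : 0 < c)
    (hc1 : c ≤ 1) (hN : 1 ≤ N) (hNn : N ≤ (n : ℝ) ^ 2) (hn : 1 ≤ n) (hm : m ≤ n) :
    ∃ s : ℕ, m * ((1 - c / N) ^ s * a ^ n ^ 2 + c * (a - 1) / (16 * n) / c) ≤ (a - 1) / 8 ∧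
      (s : ℝ) ≤ (1 / c * (1 + 16 / (a - 1)) + 1) * (n : ℝ) ^ 6 := by
  have ha1 : 0 < a - 1 := by linarith
  have hN0 : 0 < N := by linarith
  have hn1 : (1 : ℝ) ≤ n := by exact_mod_cast hn
  have hn0 : (0 : ℝ) < n := by linarith
  set X : ℝ := (n : ℝ) ^ 2 + 16 * n / (a - 1) with hX
  have hX0 : 0 ≤ X := by positivity
  refine ⟨⌈N / c * X⌉₊, ?_, ?_⟩
  · set s := ⌈N / c * X⌉₊
    have hs : N / c * X ≤ s := Nat.le_ceil _
    have h1 : (1 - c / N) ^ s ≤ Real.exp (-X) := by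
      have h2 : 0 ≤ 1 - c / N := by
        rw [sub_nonneg, div_le_one hN0]
        linarith
      refine (pow_le_pow_left₀ h2 (Real.one_sub_le_exp_neg (c / N)) s).trans ?_
      rw [← Real.exp_nat_mul, Real.exp_le_exp, mul_neg, neg_le_neg_iff]
      have h3 := mul_le_mul_of_nonneg_right hs (div_pos hc hN0).le
      have h4 : N / c * X * (c / N) = X := by field_simp
      linarith
    have h2 : a ^ n ^ 2 ≤ Real.exp ((n : ℝ) ^ 2) := by
      have h3 : a ≤ Real.exp 1 := by linarith [Real.add_one_le_exp (1 : ℝ)]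
      refine (pow_le_pow_left₀ (by linarith) h3 _).trans_eq ?_
      rw [← Real.exp_nat_mul]
      simp
    have h3 : (1 - c / N) ^ s * a ^ n ^ 2 ≤ (a - 1) / (16 * n) := by
      have h4 : 16 * n / (a - 1) ≤ Real.exp (16 * n / (a - 1)) := by
        linarith [Real.add_one_le_exp (16 * n / (a - 1))]
      have h5 : Real.exp (-X) * Real.exp ((n : ℝ) ^ 2) = (Real.exp (16 * n / (a - 1)))⁻¹ := by
        rw [← Real.exp_add, ← Real.exp_neg]
        congr 1
        rw [hX]
        ring
      refine (mul_le_mul h1 h2 (by positivity) (Real.exp_pos _).le).trans ?_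
      rw [h5]
      exact (inv_anti₀ (by positivity) h4).trans_eq (inv_div _ _)
    have h4 : c * (a - 1) / (16 * n) / c = (a - 1) / (16 * n) := by field_simp
    rw [h4]
    have h5 : (m : ℝ) ≤ n := by exact_mod_cast hm
    calc (m : ℝ) * ((1 - c / N) ^ s * a ^ n ^ 2 + (a - 1) / (16 * n))
        ≤ m * ((a - 1) / (16 * n) + (a - 1) / (16 * n)) := by gcongr
      _ ≤ n * ((a - 1) / (16 * n) + (a - 1) / (16 * n)) := by gcongr
      _ = (a - 1) / 8 := by
        field_simp
        norm_num
  · have h1 := (Nat.ceil_lt_add_one (show 0 ≤ N / c * X by positivity)).le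
    have h6 : ∀ k ≤ 6, (n : ℝ) ^ k ≤ (n : ℝ) ^ 6 := fun k hk => pow_le_pow_right₀ hn1 hk
    have h2 : X ≤ (1 + 16 / (a - 1)) * (n : ℝ) ^ 2 := by
      have h3 : (n : ℝ) ≤ (n : ℝ) ^ 2 := by nlinarith
      have h4 := mul_le_mul_of_nonneg_left h3 (show 0 ≤ 16 / (a - 1) by positivity)
      rw [hX]
      have h5 : 16 * n / (a - 1) = 16 / (a - 1) * n := by ring
      linarith
    have h3 : N / c * X ≤ 1 / c * (1 + 16 / (a - 1)) * (n : ℝ) ^ 4 := by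
      calc N / c * X ≤ (n : ℝ) ^ 2 / c * ((1 + 16 / (a - 1)) * (n : ℝ) ^ 2) := by gcongr
        _ = _ := by ring
    have h4 : 1 / c * (1 + 16 / (a - 1)) * (n : ℝ) ^ 4 ≤
        1 / c * (1 + 16 / (a - 1)) * (n : ℝ) ^ 6 :=
      mul_le_mul_of_nonneg_left (h6 4 (by norm_num)) (by positivity)
    have h5 := h6 0 (by norm_num)
    rw [pow_zero] at h5
    linarith

theorem factorial_le_exp_sq (n : ℕ) : (n.factorial : ℝ) ≤ Real.exp ((n : ℝ) ^ 2) := by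
  have h1 : (n.factorial : ℝ) ≤ (n : ℝ) ^ n := by exact_mod_cast Nat.factorial_le_pow n
  have h2 : (n : ℝ) ≤ Real.exp n := by linarith [Real.add_one_le_exp (n : ℝ)]
  refine h1.trans ((pow_le_pow_left₀ (by positivity) h2 n).trans_eq ?_)
  rw [← Real.exp_nat_mul, sq]

theorem exists_relaxation_time {K D N Z : ℝ} {n m : ℕ} (hK : 0 < K) (hD : 1 ≤ D) (hN : 1 ≤ N)
    (hNn : N ≤ (n : ℝ) ^ 2) (hn : 1 ≤ n) (hm : m ≤ n) (hZ : Z ≤ n.factorial) :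
    ∃ t : ℕ, 64 * Z ≤ (1 / (D * n)) ^ (m * n ^ 2) * Real.exp (t / (K * N)) ∧
      (t : ℝ) ≤ (K * (65 + D) + 1) * (n : ℝ) ^ 6 := by
  have hN0 : 0 < N := by linarith
  have hn1 : (1 : ℝ) ≤ n := by exact_mod_cast hn
  have hn0 : (0 : ℝ) < n := by linarith
  have hD0 : 0 < D := by linarith
  have hDn : 1 ≤ D * n := one_le_mul_of_one_le_of_one_le hD hn1
  set Y : ℝ := 64 + (n : ℝ) ^ 2 + (n : ℝ) ^ 3 * (D * n) with hY
  have hY0 : 0 ≤ Y := by positivity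
  refine ⟨⌈K * N * Y⌉₊, ?_, ?_⟩
  · have hs : K * N * Y ≤ ⌈K * N * Y⌉₊ := Nat.le_ceil _
    have h1 : Real.exp Y ≤ Real.exp (⌈K * N * Y⌉₊ / (K * N)) := by
      rw [Real.exp_le_exp, le_div_iff₀ (by positivity)]
      linarith
    have h2 : (64 : ℝ) ≤ Real.exp 64 := by linarith [Real.add_one_le_exp (64 : ℝ)]
    have h3 : (D * n) ^ (m * n ^ 2) ≤ Real.exp ((n : ℝ) ^ 3 * (D * n)) := by
      have h4 : D * n ≤ Real.exp (D * n) := by linarith [Real.add_one_le_exp (D * n)]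
      have h5 : m * n ^ 2 ≤ n ^ 3 := by
        rw [pow_succ' n 2]
        exact Nat.mul_le_mul_right _ hm
      calc (D * n) ^ (m * n ^ 2) ≤ (D * n) ^ (n ^ 3) := pow_le_pow_right₀ hDn h5
        _ ≤ Real.exp (D * n) ^ (n ^ 3) := pow_le_pow_left₀ (by positivity) h4 _
        _ = Real.exp ((n : ℝ) ^ 3 * (D * n)) := by
          rw [← Real.exp_nat_mul]
          push_cast
          rfl
    have h4 : 64 * Z * (D * n) ^ (m * n ^ 2) ≤ Real.exp Y := by
      rw [hY, Real.exp_add, Real.exp_add]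
      refine mul_le_mul ?_ h3 (by positivity) (by positivity)
      calc 64 * Z ≤ 64 * (n.factorial : ℝ) := by linarith
        _ ≤ Real.exp 64 * Real.exp ((n : ℝ) ^ 2) :=
          mul_le_mul h2 (factorial_le_exp_sq n) (by positivity) (by positivity)
    rw [one_div, inv_pow, inv_mul_eq_div, le_div_iff₀ (by positivity)]
    exact h4.trans h1
  · have h1 := (Nat.ceil_lt_add_one (show 0 ≤ K * N * Y by positivity)).le
    have h6 : ∀ k ≤ 4, (n : ℝ) ^ k ≤ (n : ℝ) ^ 4 := fun k hk => pow_le_pow_right₀ hn1 hk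
    have h2 : Y ≤ (65 + D) * (n : ℝ) ^ 4 := by
      have h3 := h6 2 (by norm_num)
      have h4 := h6 0 (by norm_num)
      rw [pow_zero] at h4
      have h5 : (n : ℝ) ^ 3 * (D * n) = D * (n : ℝ) ^ 4 := by ring
      rw [hY, h5]
      linarith
    have h3 : K * N * Y ≤ K * (65 + D) * (n : ℝ) ^ 6 := by
      calc K * N * Y ≤ K * (n : ℝ) ^ 2 * ((65 + D) * (n : ℝ) ^ 4) := by gcongr
        _ = _ := by ring
    have h4 : 1 ≤ (n : ℝ) ^ 6 := one_le_pow₀ hn1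
    linarith

theorem IsSystem.weight_le_one {Ω : Type*} [Fintype Ω] {K a c d : ℝ} {m M : ℕ} {W : Ω → ℝ}
    {G : (Ω → ℝ) → Ω → ℝ} (h : IsSystem K a c d m M W G) (x : Ω) : W x ≤ 1 := by
  obtain ⟨l, -, hW, hl⟩ := h.drift
  rw [hW x]
  clear hW
  induction l with
  | nil => simp
  | cons o l ih =>
    rw [List.map_cons, List.prod_cons]
    obtain ⟨h1, h2, -, -⟩ := hl o List.mem_cons_self
    have h3 := fun o' ho' => hl o' (List.mem_cons_of_mem _ ho')
    refine mul_le_one₀ (pow_le_one₀ h1.le h2) (List.prod_nonneg ?_) (ih h3)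
    intro y hy
    obtain ⟨o', ho', rfl⟩ := List.mem_map.1 hy
    exact pow_nonneg (h3 o' ho').1.le _

theorem mixingTime_le {T : STree} (hT : T.Valid) (hn : 2 ≤ T.numLeaves) {K a c : ℝ} (hK : 0 < K)
    (ha : 1 < a) (ha2 : a ≤ 2) (hc : 0 < c) (hc1 : c ≤ 1)
    (h : IsSystem K a c ((T.numLeaves : ℝ) * (T.numLeaves - 1) / 2) (T.numLeaves - 1)
      (T.numLeaves ^ 2) (treeW T) (treeGen T)) :
    (mixingTime (treeP T) (treePi T) : ℝ) ≤
      (1 / c * (1 + 16 / (a - 1)) + K * (65 + 16 / (c * (a - 1))) + 2) *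
        (T.numLeaves : ℝ) ^ 6 := by
  have hn2 : (2 : ℝ) ≤ T.numLeaves := by exact_mod_cast hn
  have hN : (1 : ℝ) ≤ (T.numLeaves : ℝ) * (T.numLeaves - 1) / 2 := by nlinarith
  have hNn : (T.numLeaves : ℝ) * (T.numLeaves - 1) / 2 ≤ (T.numLeaves : ℝ) ^ 2 := by nlinarith
  have ha1 : 0 < a - 1 := by linarith
  have hca : c * (a - 1) ≤ 1 := mul_le_one₀ hc1 ha1.le (by linarith)
  have hca0 : 0 < c * (a - 1) := mul_pos hc ha1
  have hP : ∀ F σ, (Matrix.mulVec (treeP T) F) σ =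
      F σ + treeGen T F σ / ((T.numLeaves : ℝ) * (T.numLeaves - 1) / 2) := by
    intro F σ
    rw [treeP_mulVec hn, Nat.cast_choose_two]
  have hZ : ∑ σ, treeW T σ ≤ T.numLeaves.factorial := by
    refine (Finset.sum_le_card_nsmul _ _ 1 fun σ _ => h.weight_le_one σ).trans_eq ?_
    simp [Fintype.card_perm]
  obtain ⟨s, hs, hs'⟩ := exists_burn_in_time (n := T.numLeaves) (m := T.numLeaves - 1) ha ha2 hc hc1
    hN hNn (by omega) (Nat.sub_le _ _)
  obtain ⟨t, ht, ht'⟩ := exists_relaxation_time (D := 16 / (c * (a - 1))) (n := T.numLeaves)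
    (m := T.numLeaves - 1) hK (by rw [le_div_iff₀ hca0]; linarith) hN hNn (by omega)
    (Nat.sub_le _ _) hZ
  have hρ : 1 / (16 / (c * (a - 1)) * T.numLeaves) = c * (a - 1) / (16 * T.numLeaves) := by
    field_simp
  rw [hρ] at ht
  have hmix : mixingTime (treeP T) (treePi T) ≤ s + t := by
    refine Nat.sInf_le fun σ t' ht' => ?_
    exact half_sum_abs_pow_sub_le h (treeP_nonneg hT) hP hN hK ha hc hc1 (by positivity)
      (by rw [div_le_one (by positivity)]; linarith) hs ht ht' σ
  have hmix' : (mixingTime (treeP T) (treePi T) : ℝ) ≤ s + t := by exact_mod_cast hmix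
  linarith

theorem mixingTime_leaf : mixingTime (treeP STree.leaf) (treePi STree.leaf) = 0 := by
  have : Unique (Fin STree.leaf.numLeaves) := inferInstanceAs (Unique (Fin 1))
  refine Nat.sInf_eq_zero.2 (Or.inr (Set.eq_empty_of_forall_notMem fun n hn => ?_))
  have h := hn 1 (n + 1) (Nat.le_succ n)
  have h1 : treeP STree.leaf = 0 := by
    funext σ τ
    simp [treeP, Subsingleton.elim _ (default : Fin STree.leaf.numLeaves)]
  have h2 : ∀ σ, treePi STree.leaf σ = 1 := by
    intro σ
    have h3 : ∀ τ, treeW STree.leaf τ = 1 := fun τ => by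
      simp [treeW, Subsingleton.elim _ (default : Fin STree.leaf.numLeaves)]
    simp [treePi, h3]
  rw [h1, zero_pow n.succ_ne_zero] at h
  norm_num [h2] at h

theorem three_le_numLeaves_node (sL sC sR : ℝ) (l c r : STree) :
    3 ≤ (STree.node sL sC sR l c r).numLeaves := by
  have h1 := numLeaves_pos l
  have h2 := numLeaves_pos c
  have h3 := numLeaves_pos r
  simp only [STree.numLeaves]
  omega

end TreeMixing

/-- For every `qb < 1/2` there is a constant `C > 0` (depending only
on `qb`, a bound on the ratios of the strengths at internal nodes, and not on `n`)
such that for every valid rooted ternary tree `T` with `n` leaves all of whose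
strength ratios are at most `qb`, the chain `M_tree` on `S_n` has mixing time
`t(M_tree) ≤ C·n¹⁰·log n`. -/
theorem tree_chain_mixing (qb : ℝ) (hqb : qb < 1 / 2) :
    ∃ C : ℝ, 0 < C ∧
      ∀ T : STree, T.Valid → T.RatioBound qb →
        (mixingTime (treeP T) (treePi T) : ℝ) ≤
          C * (T.numLeaves : ℝ) ^ 10 * Real.log (T.numLeaves : ℝ) := by
  obtain ⟨Q, hQ0, hQ, hqQ⟩ : ∃ Q : ℝ, 0 < Q ∧ Q < 1 / 2 ∧ qb ≤ Q :=
    ⟨max qb (1 / 4), lt_max_of_lt_right (by norm_num), max_lt hqb (by norm_num), le_max_left _ _⟩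
  obtain ⟨a, ha, ha2, hQa⟩ : ∃ a : ℝ, 1 < a ∧ a ≤ 2 ∧ 2 * Q * a < 1 := by
    have h1 : 1 < 1 / (2 * Q) := by
      rw [lt_div_iff₀ (by linarith)]
      linarith
    obtain ⟨a, h2, h3⟩ := exists_between (lt_min h1 (show (1 : ℝ) < 2 by norm_num))
    refine ⟨a, h2, (h3.trans_le (min_le_right _ _)).le, ?_⟩
    have h4 := h3.trans_le (min_le_left _ _)
    rw [lt_div_iff₀ (by linarith)] at h4
    linarith
  have ha0 : 0 < a := by linarith
  have ha1 : 0 < a - 1 := by linarith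
  obtain ⟨c, hc⟩ : ∃ c : ℝ, c = (a - 1) * (1 / a - 2 * Q) / 2 := ⟨_, rfl⟩
  have hb : 0 < 1 / a - 2 * Q := by
    rw [sub_pos, lt_div_iff₀ ha0]
    exact hQa
  have hc0 : 0 < c := by
    rw [hc]
    positivity
  have hc1 : c ≤ 1 := by
    have h1 : 1 / a ≤ 1 := by
      rw [div_le_one ha0]
      exact ha.le
    have h2 : (a - 1) * (1 / a - 2 * Q) ≤ 1 :=
      mul_le_one₀ (by linarith) hb.le (by linarith)
    linarith
  obtain ⟨J, hJ⟩ := pow_unbounded_of_one_lt (2 * (2 * c + 2) / c) ha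
  obtain ⟨K, hK⟩ : ∃ K : ℝ, K = 2 / c * (1 + (2 * c + 2) * TreeMixing.localConst (2 * J)) :=
    ⟨_, rfl⟩
  have hK0 : 0 < K := by
    have := TreeMixing.localConst_nonneg (2 * J)
    rw [hK]
    positivity
  have hC : 0 < 1 / c * (1 + 16 / (a - 1)) + K * (65 + 16 / (c * (a - 1))) + 2 := by positivity
  refine ⟨_, hC, fun T hT hR => ?_⟩
  cases T with
  | leaf =>
    rw [TreeMixing.mixingTime_leaf]
    simp [STree.numLeaves]
  | node sL sC sR l cc r =>
    have hn := TreeMixing.three_le_numLeaves_node sL sC sR l cc r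
    have h := TreeMixing.isSystem_tree hQ ha ha2 hQa hc hJ.le _ hT
      (TreeMixing.ratioBound_mono hqQ hR)
    rw [← hK] at h
    refine (TreeMixing.mixingTime_le hT (by omega) hK0 ha ha2 hc0 hc1 h).trans ?_
    generalize (STree.node sL sC sR l cc r).numLeaves = n at hn
    have hn3 : (3 : ℝ) ≤ n := by exact_mod_cast hn
    have h1 : (n : ℝ) ^ 6 ≤ (n : ℝ) ^ 10 := pow_le_pow_right₀ (by linarith) (by norm_num)
    have h2 : 1 ≤ Real.log n := by
      rw [Real.le_log_iff_exp_le (by linarith)]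
      linarith [Real.exp_one_lt_d9]
    rw [mul_assoc]
    refine mul_le_mul_of_nonneg_left ?_ hC.le
    exact h1.trans (le_mul_of_one_le_right (by positivity) h2)
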